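/- arXiv:1706.05603 — 4 statements merged into one kernel-verified Lean document; each statement's English description precedes it below -/
import Mathlib

section
/- For every $a > 0$ and every $R_1, R_2 \in (0,1)$ with $R_2/R_1 \ge 6$, there exist $0 < r_1 < r_2$ with $r_2 < a/4$ and $r_2/r_1 > (R_2/R_1)/6$ such that for every univalent analytic function $f$ on the unit disc with $f(0)=0$ and $|f'(0)|=a$, the annulus $\{w : r_1 \le |w| \le r_2\}$ is contained in $f(\{z : R_1 \le |z| \le R_2\})$. -/
open Set Metric MeasureTheory Filter Topology

lemma lintegral_image_eq_of_hasDerivAt {A : Set ℂ} (hA : MeasurableSet A) {f f' : ℂ → ℂ}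
    (hf : ∀ z ∈ A, HasDerivAt f (f' z) z) (hinj : InjOn f A) (g : ℂ → ENNReal) :
    ∫⁻ w in f '' A, g w = ∫⁻ z in A, ENNReal.ofReal (‖f' z‖ ^ 2) * g (f z) := by
  rw [lintegral_image_eq_lintegral_abs_det_fderiv_mul volume hA
    (fun z hz => (hf z hz).complexToReal_fderiv.hasFDerivWithinAt) hinj]
  refine setLIntegral_congr_fun hA fun z _ => ?_
  have : (f' z • (1 : ℂ →L[ℝ] ℂ)).det = ‖f' z‖ ^ 2 := by
    have h : ((f' z • (1 : ℂ →L[ℝ] ℂ) : ℂ →L[ℝ] ℂ) : ℂ →ₗ[ℝ] ℂ) = Algebra.lmul ℝ ℂ (f' z) := by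
      ext; simp
    rw [ContinuousLinearMap.det, h, ← Complex.normSq_eq_norm_sq, ← Algebra.norm_complex_apply,
      Algebra.norm_apply]
  simp only [this, abs_of_nonneg (sq_nonneg ‖f' z‖)]

lemma lintegral_eq_lintegral_circleMap {g : ℂ → ENNReal} (hg : Measurable g) :
    ∫⁻ z, g z = ∫⁻ r in Ioi (0 : ℝ), ∫⁻ θ in Ioo (-Real.pi) Real.pi,
      ENNReal.ofReal r * g (circleMap 0 r θ) := by
  rw [← Complex.lintegral_comp_polarCoord_symm, polarCoord_target,
    Measure.volume_eq_prod, ← Measure.prod_restrict, lintegral_prod]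
  · simp [circleMap, Complex.exp_mul_I]
  · simp only [Complex.polarCoord_symm_apply]
    refine Measurable.aemeasurable ?_
    fun_prop

lemma setLIntegral_Ioo_two_pi_div {s t : ℝ} (hs : 0 < s) (hst : s ≤ t) :
    ∫⁻ r in Ioo s t, ENNReal.ofReal (2 * Real.pi / r)
      = ENNReal.ofReal (2 * Real.pi * Real.log (t / s)) := by
  rw [← integral_inv_of_pos hs (hs.trans_le hst), ← intervalIntegral.integral_const_mul,
    intervalIntegral.integral_of_le hst, integral_Ioc_eq_integral_Ioo,
    ofReal_integral_eq_lintegral_ofReal]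
  · simp [div_eq_mul_inv]
  · have : ContinuousOn (fun r : ℝ => 2 * Real.pi * r⁻¹) (Icc s t) :=
      continuousOn_const.mul (continuousOn_inv₀.mono fun r hr => (hs.trans_le hr.1).ne')
    exact this.integrableOn_Icc.mono_set Ioo_subset_Icc_self
  · filter_upwards [ae_restrict_mem measurableSet_Ioo] with r hr
    have := hs.trans hr.1
    have := Real.pi_pos
    simp only [Pi.zero_apply]
    positivity

lemma lintegral_annulus_inv_sq {s t : ℝ} (hs : 0 < s) (hst : s ≤ t) :
    ∫⁻ w in {w : ℂ | s ≤ ‖w‖ ∧ ‖w‖ ≤ t}, ENNReal.ofReal ((‖w‖ ^ 2)⁻¹)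
      = ENNReal.ofReal (2 * Real.pi * Real.log (t / s)) := by
  have hm : MeasurableSet {w : ℂ | s ≤ ‖w‖ ∧ ‖w‖ ≤ t} :=
    (measurableSet_le measurable_const measurable_norm).inter
      (measurableSet_le measurable_norm measurable_const)
  rw [← lintegral_indicator hm, lintegral_eq_lintegral_circleMap
    ((by fun_prop : Measurable fun w : ℂ => ENNReal.ofReal ((‖w‖ ^ 2)⁻¹)).indicator hm),
    ← setLIntegral_Ioo_two_pi_div hs hst, setLIntegral_congr Ioo_ae_eq_Icc,
    ← lintegral_indicator measurableSet_Icc, ← lintegral_indicator measurableSet_Ioi]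
  congr 1 with r
  by_cases h0 : 0 < r
  · by_cases hr : r ∈ Icc s t
    · have : r ∈ Ioi (0:ℝ) := h0
      have h2 : ∀ θ, circleMap 0 r θ ∈ {w : ℂ | s ≤ ‖w‖ ∧ ‖w‖ ≤ t} := fun θ => by
        simpa [abs_of_pos h0] using hr
      simp only [indicator_of_mem, hr, this, h2]
      simp only [norm_circleMap_zero, abs_of_pos h0, lintegral_const, Measure.restrict_apply_univ,
        Real.volume_Ioo]
      rw [← ENNReal.ofReal_mul h0.le, ← ENNReal.ofReal_mul (by positivity)]
      congr 1
      field_simp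
      ring
    · have : r ∈ Ioi (0:ℝ) := h0
      have h2 : ∀ θ, circleMap 0 r θ ∉ {w : ℂ | s ≤ ‖w‖ ∧ ‖w‖ ≤ t} := fun θ => by
        simpa [abs_of_pos h0] using hr
      simp only [indicator_of_mem this, indicator_of_notMem hr, indicator_of_notMem (h2 _)]
      simp
  · rw [indicator_of_notMem (by simpa using h0), indicator_of_notMem]
    exact fun h => h0 (hs.trans_le h.1)

lemma lintegral_inv_image_inv_sq {E : Set ℂ} (hE : MeasurableSet E) (h0 : (0 : ℂ) ∉ E) :
    ∫⁻ w in (fun w => w⁻¹) '' E, ENNReal.ofReal ((‖w‖ ^ 2)⁻¹)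
      = ∫⁻ w in E, ENNReal.ofReal ((‖w‖ ^ 2)⁻¹) := by
  rw [lintegral_image_eq_of_hasDerivAt hE
    (fun z hz => hasDerivAt_inv (ne_of_mem_of_not_mem hz h0)) inv_injective.injOn]
  refine setLIntegral_congr_fun hE fun z hz => ?_
  have hz0 : z ≠ 0 := ne_of_mem_of_not_mem hz h0
  rw [← ENNReal.ofReal_mul (by positivity)]
  congr 1
  have := norm_pos_iff.2 hz0
  simp
  field_simp

lemma one_le_integral_norm_sq {H : ℂ → ℂ} (hH : DifferentiableOn ℂ H (ball 0 1)) (h1 : H 0 = 1)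
    {r : ℝ} (hr : 0 < r) (hr1 : r < 1) :
    ENNReal.ofReal (2 * Real.pi) ≤
      ∫⁻ θ in Ioo (-Real.pi) Real.pi, ENNReal.ofReal (‖H (circleMap 0 r θ)‖ ^ 2) := by
  have hcl : closedBall (0:ℂ) r ⊆ ball 0 1 := closedBall_subset_ball hr1
  have hcirc : Continuous fun θ => H (circleMap 0 r θ) := by
    refine hH.continuousOn.comp_continuous (continuous_circleMap 0 r) fun θ => ?_
    simpa [abs_of_pos hr] using hr1
  have hd : DiffContOnCl ℂ H (ball 0 |r|) := by
    rw [abs_of_pos hr]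
    refine ⟨hH.mono (ball_subset_closedBall.trans hcl), ?_⟩
    rw [closure_ball _ hr.ne']
    exact hH.continuousOn.mono hcl
  have hre : Continuous fun θ => 2 * (H (circleMap 0 r θ)).re :=
    continuous_const.mul (Complex.continuous_re.comp hcirc)
  have hsq : Continuous fun θ => ‖H (circleMap 0 r θ)‖ ^ 2 := hcirc.norm.pow 2
  have hmean := hd.circleAverage
  have hper : Function.Periodic (fun θ => H (circleMap 0 r θ)) (2 * Real.pi) := fun θ => by
    simp [periodic_circleMap 0 r θ]
  have hint : ∫ θ in (-Real.pi)..Real.pi, H (circleMap 0 r θ) = 2 * Real.pi := by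
    have h2 := hper.intervalIntegral_add_eq (-Real.pi) 0
    rw [show -Real.pi + 2 * Real.pi = Real.pi by ring, zero_add] at h2
    rw [h2]
    rw [Real.circleAverage_def, h1] at hmean
    have := congrArg (fun x => (2 * Real.pi : ℝ) • x) hmean
    rw [smul_inv_smul₀ (by positivity)] at this
    simpa using this
  have hpi : -Real.pi ≤ Real.pi := by linarith [Real.pi_pos]
  rw [← ofReal_integral_eq_lintegral_ofReal, ← integral_Ioc_eq_integral_Ioo,
    ← intervalIntegral.integral_of_le hpi]
  · apply ENNReal.ofReal_le_ofReal
    have hre_int : ∫ θ in (-Real.pi)..Real.pi, (2 * (H (circleMap 0 r θ)).re - 1) = 2 * Real.pi := by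
      rw [intervalIntegral.integral_sub, intervalIntegral.integral_const_mul]
      · have h3 := Complex.reCLM.intervalIntegral_comp_comm (hcirc.intervalIntegrable
          (μ := volume) (-Real.pi) Real.pi)
        simp only [Complex.reCLM_apply] at h3
        rw [h3, hint]
        simp
        ring
      · exact hre.intervalIntegrable _ _
      · exact intervalIntegrable_const
    rw [← hre_int]
    refine intervalIntegral.integral_mono_on hpi
      ((hre.sub continuous_const).intervalIntegrable _ _) (hsq.intervalIntegrable _ _) fun θ _ => ?_
    rw [← Complex.normSq_eq_norm_sq, Complex.normSq_apply]
    nlinarith [sq_nonneg ((H (circleMap 0 r θ)).re - 1), sq_nonneg (H (circleMap 0 r θ)).im]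
  · exact hsq.integrableOn_Icc.mono_set Ioo_subset_Icc_self
  · exact Eventually.of_forall fun θ => by positivity

lemma log_div_le_lintegral_image_annulus {Q : ℂ → ℂ} (hQ : DifferentiableOn ℂ Q (ball 0 1))
    (hinj : InjOn Q (ball 0 1)) (h0 : Q 0 = 0) (hd : deriv Q 0 ≠ 0) {s t : ℝ} (hs : 0 < s)
    (hst : s ≤ t) (ht : t < 1) :
    ENNReal.ofReal (2 * Real.pi * Real.log (t / s)) ≤
      ∫⁻ w in Q '' {z : ℂ | s < ‖z‖ ∧ ‖z‖ < t}, ENNReal.ofReal ((‖w‖ ^ 2)⁻¹) := by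
  set A : Set ℂ := {z : ℂ | s < ‖z‖ ∧ ‖z‖ < t} with hAdef
  have hAo : IsOpen A := (isOpen_lt continuous_const continuous_norm).inter
    (isOpen_lt continuous_norm continuous_const)
  have hAb : A ⊆ ball 0 1 := fun z hz => by simpa using hz.2.trans ht
  have hmem0 : (0 : ℂ) ∈ ball (0 : ℂ) 1 := by simp
  have hball : ball (0 : ℂ) 1 ∈ 𝓝 (0 : ℂ) := ball_mem_nhds _ one_pos
  have hQne : ∀ z ∈ ball (0 : ℂ) 1, z ≠ 0 → Q z ≠ 0 := fun z hz hz0 h =>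
    hz0 (hinj hz hmem0 (h.trans h0.symm))
  have hQ' : DifferentiableOn ℂ (deriv Q) (ball 0 1) := hQ.deriv isOpen_ball
  have hD : DifferentiableOn ℂ (dslope Q 0) (ball 0 1) :=
    (Complex.differentiableOn_dslope hball).2 hQ
  have hDval : ∀ z, z ≠ 0 → dslope Q 0 z = Q z / z := fun z hz => by
    rw [dslope_of_ne _ hz, slope_def_field, h0, sub_zero, sub_zero]
  have hDne : ∀ z ∈ ball (0 : ℂ) 1, dslope Q 0 z ≠ 0 := fun z hz => by
    rcases eq_or_ne z 0 with rfl | hz0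
    · rwa [dslope_same]
    · rw [hDval z hz0]
      exact div_ne_zero (hQne z hz hz0) hz0
  have hH := hQ'.fun_div hD hDne
  have hH1 : deriv Q 0 / dslope Q 0 0 = 1 := by rw [dslope_same, div_self hd]
  rw [lintegral_image_eq_of_hasDerivAt hAo.measurableSet
    (fun z hz => (hQ.differentiableAt (isOpen_ball.mem_nhds (hAb hz))).hasDerivAt)
    (hinj.mono hAb)]
  have hcongr : ∀ z ∈ A, ENNReal.ofReal (‖deriv Q z‖ ^ 2) * ENNReal.ofReal ((‖Q z‖ ^ 2)⁻¹)
      = ENNReal.ofReal (‖deriv Q z / dslope Q 0 z‖ ^ 2 / ‖z‖ ^ 2) := fun z hz => by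
    have hz0 : z ≠ 0 := norm_pos_iff.1 (hs.trans hz.1)
    have := norm_pos_iff.2 hz0
    have := norm_pos_iff.2 (hQne z (hAb hz) hz0)
    rw [← ENNReal.ofReal_mul (by positivity), hDval z hz0]
    congr 1
    simp only [norm_div]
    field_simp
  rw [setLIntegral_congr_fun hAo.measurableSet hcongr, ← lintegral_indicator hAo.measurableSet]
  have hmeas : Measurable (A.indicator fun z =>
      ENNReal.ofReal (‖deriv Q z / dslope Q 0 z‖ ^ 2 / ‖z‖ ^ 2)) := by
    classical
    rw [← piecewise_eq_indicator]
    refine ContinuousOn.measurable_piecewise ?_ continuousOn_const hAo.measurableSet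
    refine ENNReal.continuous_ofReal.comp_continuousOn
      (((hH.continuousOn.mono hAb).norm.pow 2).div (by fun_prop) fun z hz => ?_)
    have := hs.trans hz.1
    positivity
  rw [lintegral_eq_lintegral_circleMap hmeas, ← setLIntegral_Ioo_two_pi_div hs hst]
  refine (setLIntegral_mono' measurableSet_Ioo fun r hr => ?_).trans
    (lintegral_mono_set (fun r hr => hs.trans hr.1 : Ioo s t ⊆ Ioi 0))
  have hr0 : 0 < r := hs.trans hr.1
  have hA : ∀ θ, circleMap 0 r θ ∈ A := fun θ => by simpa [hAdef, abs_of_pos hr0] using hr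
  calc ENNReal.ofReal (2 * Real.pi / r)
      = ENNReal.ofReal r⁻¹ * ENNReal.ofReal (2 * Real.pi) := by
        rw [← ENNReal.ofReal_mul (by positivity), div_eq_inv_mul]
    _ ≤ ENNReal.ofReal r⁻¹ * ∫⁻ θ in Ioo (-Real.pi) Real.pi, ENNReal.ofReal
          (‖deriv Q (circleMap 0 r θ) / dslope Q 0 (circleMap 0 r θ)‖ ^ 2) :=
        mul_le_mul_right (one_le_integral_norm_sq hH hH1 hr0 (hr.2.trans ht)) _
    _ = _ := by
        rw [← lintegral_const_mul' _ _ ENNReal.ofReal_ne_top]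
        refine lintegral_congr fun θ => ?_
        rw [indicator_of_mem (hA θ), ← ENNReal.ofReal_mul (by positivity),
          ← ENNReal.ofReal_mul (by positivity), norm_circleMap_zero, abs_of_pos hr0]
        congr 1
        field_simp

/-- Near a zero with nonvanishing derivative, an analytic function covers small discs by discs
whose radius is larger by any factor above the one the derivative predicts. -/
lemma eventually_ball_subset_image_closedBall {Q : ℂ → ℂ} (hQ : AnalyticAt ℂ Q 0)
    (h0 : Q 0 = 0) (hd : deriv Q 0 ≠ 0) {K : ℝ} (hK : ‖deriv Q 0‖⁻¹ < K) :
    ∀ᶠ ε in 𝓝[>] (0 : ℝ), ball 0 ε ⊆ Q '' closedBall 0 (K * ε) := by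
  have hs := hQ.hasStrictDerivAt
  set G := hs.localInverse Q _ _ hd
  have hG : HasStrictDerivAt G (deriv Q 0)⁻¹ (Q 0) := hs.to_localInverse hd
  have hr : ∀ᶠ w in 𝓝 (0 : ℂ), Q (G w) = w := by
    have := (hs.hasStrictFDerivAt_equiv hd).eventually_right_inverse
    rwa [h0] at this
  have hG0 : G 0 = 0 := by
    have := (hs.hasStrictFDerivAt_equiv hd).localInverse_apply_image
    rwa [h0] at this
  rw [h0] at hG
  have hb : ∀ᶠ w in 𝓝 (0 : ℂ), ‖G w‖ ≤ K * ‖w‖ := by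
    have h1 := hG.hasDerivAt.isLittleO
    have h2 := h1.bound (sub_pos.2 hK)
    filter_upwards [h2] with w hw
    simp only [hG0, sub_zero, smul_eq_mul] at hw
    calc ‖G w‖ = ‖(G w - w * (deriv Q 0)⁻¹) + w * (deriv Q 0)⁻¹‖ := by ring_nf
      _ ≤ (K - ‖deriv Q 0‖⁻¹) * ‖w‖ + ‖w‖ * ‖deriv Q 0‖⁻¹ := by
        refine (norm_add_le _ _).trans ?_
        rw [norm_mul w, norm_inv]
        gcongr
      _ = K * ‖w‖ := by ring
  obtain ⟨δ, hδ, h⟩ := Metric.eventually_nhds_iff_ball.1 (hr.and hb)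
  filter_upwards [Ioo_mem_nhdsGT hδ] with ε hε w hw
  have hw' := h w (ball_subset_ball hε.2.le hw)
  have hK0 : 0 < K := (inv_pos.2 (norm_pos_iff.2 hd)).trans hK
  refine ⟨G w, ?_, hw'.1⟩
  rw [mem_closedBall_zero_iff]
  rw [mem_ball_zero_iff] at hw
  exact hw'.2.trans (by gcongr)

/-- **Bieberbach–Eilenberg**, univalent case. -/
lemma norm_deriv_zero_le_one_of_mul_ne_one {Q : ℂ → ℂ} (hQ : DifferentiableOn ℂ Q (ball 0 1))
    (hinj : InjOn Q (ball 0 1)) (h0 : Q 0 = 0)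
    (hmul : ∀ z ∈ ball (0 : ℂ) 1, ∀ w ∈ ball (0 : ℂ) 1, Q z * Q w ≠ 1) :
    ‖deriv Q 0‖ ≤ 1 := by
  by_contra! hlt
  have hd : deriv Q 0 ≠ 0 := fun h => by norm_num [h] at hlt
  obtain ⟨K, hK, hK1⟩ := exists_between (inv_lt_one_of_one_lt₀ hlt)
  obtain ⟨t, hKt, ht⟩ := exists_between hK1
  have hK0 : 0 < K := (inv_pos.2 (zero_lt_one.trans hlt)).trans hK
  have ht0 : 0 < t := hK0.trans hKt
  have hev := eventually_ball_subset_image_closedBall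
    (hQ.analyticAt (ball_mem_nhds _ one_pos)) h0 hd hK
  obtain ⟨ε, hcov, hε0, hεt⟩ := (hev.and (Ioo_mem_nhdsGT ht0)).exists
  have hε1 : ε < 1 := hεt.trans ht
  have hsK : K * ε < ε := by nlinarith
  have hs0 : 0 < K * ε := by positivity
  have hst : K * ε < t := hsK.trans hεt
  set A : Set ℂ := {z : ℂ | K * ε < ‖z‖ ∧ ‖z‖ < t} with hAdef
  have hAo : IsOpen A := (isOpen_lt continuous_const continuous_norm).inter
    (isOpen_lt continuous_norm continuous_const)
  have hAb : A ⊆ ball 0 1 := fun z hz => by simpa using hz.2.trans ht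
  have hfar : ∀ z ∈ A, ε ≤ ‖Q z‖ := fun z hz => by
    by_contra! h
    obtain ⟨y, hy, hyz⟩ := hcov (mem_ball_zero_iff.2 h)
    rw [mem_closedBall_zero_iff] at hy
    have := hinj (mem_ball_zero_iff.2 (hy.trans_lt (hst.trans ht))) (hAb hz) hyz
    subst this
    exact hz.1.not_ge hy
  have hnear : ∀ z ∈ A, ‖Q z‖ ≤ ε⁻¹ := fun z hz => by
    by_contra! h
    have hpos : 0 < ‖Q z‖ := (inv_pos.2 hε0).trans h
    have : (Q z)⁻¹ ∈ ball (0 : ℂ) ε := by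
      rw [mem_ball_zero_iff, norm_inv]
      exact inv_lt_of_inv_lt₀ hε0 h
    obtain ⟨y, hy, hyz⟩ := hcov this
    rw [mem_closedBall_zero_iff] at hy
    refine hmul z (hAb hz) y (mem_ball_zero_iff.2 (hy.trans_lt (hst.trans ht))) ?_
    rw [hyz, mul_inv_cancel₀ (norm_pos_iff.1 hpos)]
  have hmE : MeasurableSet (Q '' A) :=
    hAo.measurableSet.image_of_continuousOn_injOn (hQ.continuousOn.mono hAb) (hinj.mono hAb)
  have h0E : (0 : ℂ) ∉ Q '' A := by
    rintro ⟨z, hz, hz0⟩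
    have := hfar z hz
    rw [hz0, norm_zero] at this
    exact hε0.not_ge this
  have hmE' : MeasurableSet ((fun w : ℂ => w⁻¹) '' (Q '' A)) := by
    rw [image_inv_eq_inv]
    exact hmE.inv
  have hdisj : Disjoint (Q '' A) ((fun w : ℂ => w⁻¹) '' (Q '' A)) := by
    rw [Set.disjoint_left]
    rintro _ ⟨z, hz, rfl⟩ ⟨_, ⟨y, hy, rfl⟩, hyz⟩
    refine hmul z (hAb hz) y (hAb hy) ?_
    rw [← hyz]
    exact inv_mul_cancel₀ fun h => h0E ⟨y, hy, h⟩
  have hsub : Q '' A ∪ (fun w : ℂ => w⁻¹) '' (Q '' A) ⊆ {w : ℂ | ε ≤ ‖w‖ ∧ ‖w‖ ≤ ε⁻¹} := by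
    rintro _ (⟨z, hz, rfl⟩ | ⟨_, ⟨z, hz, rfl⟩, rfl⟩)
    · exact ⟨hfar z hz, hnear z hz⟩
    · have hpos : 0 < ‖Q z‖ := hε0.trans_le (hfar z hz)
      simp only [mem_ofPred_eq, norm_inv]
      exact ⟨le_inv_of_le_inv₀ hpos (hnear z hz), inv_anti₀ hε0 (hfar z hz)⟩
  have hlow := log_div_le_lintegral_image_annulus hQ hinj h0 hd hs0 hst.le ht
  have key : ENNReal.ofReal (2 * Real.pi * Real.log (t / (K * ε))) +
      ENNReal.ofReal (2 * Real.pi * Real.log (t / (K * ε))) ≤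
        ENNReal.ofReal (2 * Real.pi * Real.log (ε⁻¹ / ε)) := by
    rw [← lintegral_annulus_inv_sq hε0 (hε1.le.trans ((one_le_inv₀ hε0).2 hε1.le))]
    refine le_trans ?_ (lintegral_mono_set hsub)
    rw [lintegral_union hmE' hdisj, lintegral_inv_image_inv_sq hmE h0E]
    exact add_le_add hlow hlow
  have hlog : 0 ≤ Real.log (t / (K * ε)) := Real.log_nonneg ((one_le_div hs0).2 hst.le)
  have hpi := Real.pi_pos
  rw [← ENNReal.ofReal_add (by positivity) (by positivity)] at key
  have hε2 : Real.log (ε⁻¹ / ε) = 2 * Real.log ε⁻¹ := by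
    rw [Real.log_div (by positivity) hε0.ne', Real.log_inv]; ring
  have hneg : 0 ≤ Real.log ε⁻¹ := Real.log_nonneg ((one_le_inv₀ hε0).2 hε1.le)
  rw [hε2] at key
  have key2 := (ENNReal.ofReal_le_ofReal_iff (by positivity)).1 key
  have key3 : Real.log (t / (K * ε)) ≤ Real.log ε⁻¹ := by nlinarith
  have key4 := (Real.log_le_log_iff (by positivity) (by positivity)).1 key3
  rw [div_le_iff₀ hs0, mul_comm K, inv_mul_cancel_left₀ hε0.ne'] at key4
  exact hKt.not_ge key4

lemma exists_differentiableOn_sq_eq {F : ℂ → ℂ} (hF : DifferentiableOn ℂ F (ball 0 1))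
    (hne : ∀ z ∈ ball (0 : ℂ) 1, F z ≠ 0) (h1 : F 0 = 1) :
    ∃ S : ℂ → ℂ, DifferentiableOn ℂ S (ball 0 1) ∧ S 0 = 1 ∧ ∀ z ∈ ball (0 : ℂ) 1, S z ^ 2 = F z := by
  have hF' : DifferentiableOn ℂ (fun z => deriv F z / F z) (ball 0 1) :=
    (hF.deriv isOpen_ball).fun_div hF hne
  obtain ⟨L, hL0, hL⟩ := hF'.isExactOn_ball.with_val_at 0 0
  have hFd : ∀ z ∈ ball (0 : ℂ) 1, HasDerivAt F (deriv F z) z := fun z hz =>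
    (hF.differentiableAt (isOpen_ball.mem_nhds hz)).hasDerivAt
  have hder : ∀ z ∈ ball (0 : ℂ) 1, HasDerivAt (fun z => F z * Complex.exp (-L z)) 0 z := by
    intro z hz
    refine ((hFd z hz).fun_mul (hL z hz).fun_neg.cexp).congr_deriv ?_
    have := hne z hz
    field_simp
    ring
  have hconst : ∀ z ∈ ball (0 : ℂ) 1, F z * Complex.exp (-L z) = 1 := fun z hz => by
    have := isOpen_ball.is_const_of_deriv_eq_zero (convex_ball (0 : ℂ) 1).isPreconnected
      (fun z hz => (hder z hz).differentiableAt.differentiableWithinAt)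
      (fun z hz => (hder z hz).deriv) hz (by simp : (0 : ℂ) ∈ ball (0 : ℂ) 1)
    simpa [h1, hL0] using this
  refine ⟨fun z => Complex.exp (L z / 2), fun z hz => ?_, by simp [hL0], fun z hz => ?_⟩
  · exact ((hL z hz).differentiableAt.div_const 2).cexp.differentiableWithinAt
  · have := hconst z hz
    rw [Complex.exp_neg, mul_inv_eq_one₀ (Complex.exp_ne_zero _)] at this
    rw [← Complex.exp_nat_mul, this]
    congr 1
    push_cast
    ring

/-- The **Koebe quarter theorem**. -/
theorem koebe_quarter {f : ℂ → ℂ} (hf : DifferentiableOn ℂ f (ball 0 1))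
    (hinj : InjOn f (ball 0 1)) (h0 : f 0 = 0) {w : ℂ} (hw : w ∉ f '' ball 0 1) :
    ‖deriv f 0‖ / 4 ≤ ‖w‖ := by
  have hmem0 : (0 : ℂ) ∈ ball (0 : ℂ) 1 := by simp
  have hball : ball (0 : ℂ) 1 ∈ 𝓝 (0 : ℂ) := ball_mem_nhds _ one_pos
  have hw0 : w ≠ 0 := fun h => hw ⟨0, hmem0, h0.trans h.symm⟩
  obtain ⟨S, hS, hS0, hSsq⟩ := exists_differentiableOn_sq_eq (F := fun z => 1 - f z / w)
    ((differentiableOn_const _).sub (hf.div_const w))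
    (fun z hz h => hw ⟨z, hz, by rw [sub_eq_zero, eq_div_iff hw0] at h; simpa using h.symm⟩)
    (by simp [h0])
  have hSne : ∀ z ∈ ball (0 : ℂ) 1, S z ≠ 0 := fun z hz h => hw ⟨z, hz, by
    have := hSsq z hz
    rw [h] at this
    field_simp at this
    linear_combination this⟩
  have hSinj : ∀ z ∈ ball (0 : ℂ) 1, ∀ y ∈ ball (0 : ℂ) 1, S z ^ 2 = S y ^ 2 → z = y := by
    intro z hz y hy h
    rw [hSsq z hz, hSsq y hy, sub_right_inj, div_left_inj' hw0] at h
    exact hinj hz hy h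
  have hSadd : ∀ z ∈ ball (0 : ℂ) 1, ∀ y ∈ ball (0 : ℂ) 1, S z + S y ≠ 0 := by
    intro z hz y hy h
    have hzy := hSinj z hz y hy (by linear_combination (S z - S y) * h)
    subst hzy
    exact hSne z hz (by linear_combination h / 2)
  have hSne1 : ∀ z ∈ ball (0 : ℂ) 1, 1 + S z ≠ 0 := fun z hz => hS0 ▸ hSadd 0 hmem0 z hz
  have hQ : DifferentiableOn ℂ (fun z => (1 - S z) / (1 + S z)) (ball 0 1) :=
    ((differentiableOn_const _).sub hS).fun_div ((differentiableOn_const _).add hS) hSne1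
  have hSd : HasDerivAt S (deriv S 0) 0 := (hS.differentiableAt hball).hasDerivAt
  have hQd : HasDerivAt (fun z => (1 - S z) / (1 + S z)) (deriv f 0 / (4 * w)) 0 := by
    have hfd : HasDerivAt f (deriv f 0) 0 := (hf.differentiableAt hball).hasDerivAt
    have e1 : HasDerivAt (fun z => S z ^ 2) (-(deriv f 0 / w)) 0 := by
      refine ((hfd.div_const w).const_sub 1).congr_of_eventuallyEq ?_
      filter_upwards [hball] with z hz using hSsq z hz
    have e2 := e1.unique (hSd.fun_pow 2)
    rw [hS0] at e2
    refine ((hSd.const_sub 1).fun_div (hSd.const_add 1) (hSne1 0 hmem0)).congr_deriv ?_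
    rw [hS0]
    field_simp at e2 ⊢
    norm_num at e2 ⊢
    linear_combination 4 * e2
  have hmain := norm_deriv_zero_le_one_of_mul_ne_one hQ ?_ (by simp [hS0]) ?_
  · have := norm_pos_iff.2 hw0
    rw [hQd.deriv, norm_div, norm_mul, Complex.norm_ofNat, div_le_one (by positivity)] at hmain
    linarith
  · intro z hz y hy h
    simp only at h
    rw [div_eq_div_iff (hSne1 z hz) (hSne1 y hy)] at h
    exact hSinj z hz y hy (by linear_combination (-(S z + S y) / 2) * h)
  · intro z hz y hy h
    rw [div_mul_div_comm, div_eq_one_iff_eq (mul_ne_zero (hSne1 z hz) (hSne1 y hy))] at h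
    exact hSadd z hz y hy (by linear_combination -h / 2)

/-- The conformal map of the unit disc onto the disc slit along `[r, 1)`. -/
lemma exists_slit_map {r : ℝ} (hr : 0 < r) (hr1 : r < 1) :
    ∃ φ : ℂ → ℂ, DifferentiableOn ℂ φ (ball 0 1) ∧ MapsTo φ (ball 0 1) (ball 0 1) ∧
      InjOn φ (ball 0 1) ∧ φ 0 = 0 ∧ deriv φ 0 = (4 * r / (1 + r) ^ 2 : ℝ) ∧
      ∀ z ∈ ball (0 : ℂ) 1, φ z ≠ r := by
  set c : ℝ := 4 * r / (1 + r) ^ 2 with hc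
  have hc0 : 0 < c := by positivity
  have hc1 : c < 1 := by
    rw [hc, div_lt_one (by positivity)]
    nlinarith [sq_pos_of_pos (sub_pos.2 hr1)]
  have hmem0 : (0 : ℂ) ∈ ball (0 : ℂ) 1 := by simp
  have hne : ∀ z ∈ ball (0 : ℂ) 1, 1 + z ≠ 0 := fun z hz h => by
    rw [mem_ball_zero_iff, show z = -1 by linear_combination h] at hz
    norm_num at hz
  set ζ : ℂ → ℂ := fun z => (1 - z) / (1 + z) with hζ
  have hζd : ∀ z ∈ ball (0 : ℂ) 1, HasDerivAt ζ (-2 / (1 + z) ^ 2) z := fun z hz => by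
    refine (((hasDerivAt_id' z).const_sub 1).fun_div ((hasDerivAt_id' z).const_add 1)
      (hne z hz)).congr_deriv ?_
    ring
  have hζre : ∀ z ∈ ball (0 : ℂ) 1, 0 < (ζ z).re := fun z hz => by
    have h1 : (ζ z).re = (1 - Complex.normSq z) / Complex.normSq (1 + z) := by
      simp only [hζ, Complex.div_re, Complex.normSq_apply]
      simp
      ring
    rw [h1]
    refine div_pos ?_ (Complex.normSq_pos.2 (hne z hz))
    rw [mem_ball_zero_iff] at hz
    rw [Complex.normSq_eq_norm_sq]
    nlinarith [norm_nonneg z]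
  set F : ℂ → ℂ := fun z => 1 - c + c * ζ z ^ 2 with hF
  have hFs : ∀ z ∈ ball (0 : ℂ) 1, F z ∈ Complex.slitPlane := fun z hz => by
    have h := hζre z hz
    rw [Complex.mem_slitPlane_iff]
    by_cases him : (ζ z).im = 0
    · left
      simp [hF, sq, him]
      nlinarith [mul_pos hc0 (mul_pos h h)]
    · right
      simp [hF, sq]
      refine ⟨hc0.ne', fun h2 => ?_⟩
      have : (ζ z).re * (ζ z).im = 0 := by linarith
      exact (mul_ne_zero h.ne' him) this
  set S : ℂ → ℂ := fun z => Complex.exp (Complex.log (F z) / 2) with hS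
  have hSsq : ∀ z ∈ ball (0 : ℂ) 1, S z ^ 2 = F z := fun z hz => by
    rw [hS, ← Complex.exp_nat_mul]
    push_cast
    rw [mul_div_cancel₀ _ two_ne_zero, Complex.exp_log (Complex.slitPlane_ne_zero (hFs z hz))]
  have hSre : ∀ z ∈ ball (0 : ℂ) 1, 0 < (S z).re := fun z hz => by
    simp only [hS, Complex.exp_re]
    refine mul_pos (Real.exp_pos _) (Real.cos_pos_of_mem_Ioo ?_)
    have h1 := Complex.neg_pi_lt_arg (F z)
    have h2 := lt_of_le_of_ne (Complex.arg_le_pi (F z))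
      (Complex.mem_slitPlane_iff_arg.1 (hFs z hz)).1
    have h3 : (Complex.log (F z) / 2).im = (F z).arg / 2 := by
      rw [← Complex.log_im]
      simp
    rw [h3]
    constructor <;> linarith
  have hFd : ∀ z ∈ ball (0 : ℂ) 1, HasDerivAt F (c * (2 * ζ z * (-2 / (1 + z) ^ 2))) z :=
    fun z hz =>
      ((((hζd z hz).fun_pow 2).const_mul (c : ℂ)).const_add (1 - c : ℂ)).congr_deriv (by simp)
  have hSd : ∀ z ∈ ball (0 : ℂ) 1, DifferentiableAt ℂ S z := fun z hz =>
    (((hFd z hz).clog (hFs z hz)).div_const 2).cexp.differentiableAt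
  have hSne1 : ∀ z ∈ ball (0 : ℂ) 1, 1 + S z ≠ 0 := fun z hz h => by
    have h1 := congrArg Complex.re h
    have := hSre z hz
    simp at h1
    linarith
  have hζ0 : ζ 0 = 1 := by simp [hζ]
  have hF0 : F 0 = 1 := by simp [hF, hζ0]
  have hS0 : S 0 = 1 := by simp [hS, hF0]
  refine ⟨fun z => (1 - S z) / (1 + S z), fun z hz => ?_, fun z hz => ?_, fun z hz y hy h => ?_,
    by simp [hS0], ?_, fun z hz h => ?_⟩
  · exact (((differentiableAt_const _).sub (hSd z hz)).fun_div
      ((differentiableAt_const _).add (hSd z hz)) (hSne1 z hz)).differentiableWithinAt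
  · have h := hSre z hz
    rw [mem_ball_zero_iff, norm_div, div_lt_one (norm_pos_iff.2 (hSne1 z hz)),
      ← sq_lt_sq₀ (norm_nonneg _) (norm_nonneg _), ← Complex.normSq_eq_norm_sq,
      ← Complex.normSq_eq_norm_sq, Complex.normSq_apply, Complex.normSq_apply]
    simp
    nlinarith
  · simp only at h
    rw [div_eq_div_iff (hSne1 z hz) (hSne1 y hy)] at h
    have h1 : S z = S y := by linear_combination -h / 2
    have h2 : F z = F y := by rw [← hSsq z hz, ← hSsq y hy, h1]
    have h3 : (ζ z - ζ y) * (ζ z + ζ y) = 0 := by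
      have hc' : (c : ℂ) ≠ 0 := by exact_mod_cast hc0.ne'
      refine mul_left_cancel₀ hc' ?_
      simp only [hF] at h2
      linear_combination h2
    have h4 : ζ z + ζ y ≠ 0 := fun h => by
      have h5 := congrArg Complex.re h
      have := hζre z hz
      have := hζre y hy
      simp at h5
      linarith
    have h6 : ζ z = ζ y := sub_eq_zero.1 ((mul_eq_zero.1 h3).resolve_right h4)
    simp only [hζ] at h6
    rw [div_eq_div_iff (hne z hz) (hne y hy)] at h6
    linear_combination -h6 / 2
  · have h1 := ((hSd 0 hmem0).hasDerivAt.fun_pow 2).unique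
      ((hFd 0 hmem0).congr_of_eventuallyEq (by
        filter_upwards [ball_mem_nhds (0 : ℂ) one_pos] with z hz using hSsq z hz))
    rw [hS0, hζ0] at h1
    have h2 := ((hSd 0 hmem0).hasDerivAt.const_sub 1).fun_div
      ((hSd 0 hmem0).hasDerivAt.const_add 1) (hSne1 0 hmem0)
    rw [h2.deriv, hS0]
    norm_num at h1 ⊢
    linear_combination -h1 / 4
  · rw [div_eq_iff (hSne1 z hz)] at h
    have hr' : (1 + r : ℂ) ≠ 0 := by exact_mod_cast (by positivity : (1 + r : ℝ) ≠ 0)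
    have h1 : S z = (1 - r) / (1 + r) := by
      rw [eq_div_iff hr']
      linear_combination -h
    have h2 := hSsq z hz
    rw [h1] at h2
    have h3 : (c : ℂ) = 4 * r / (1 + r) ^ 2 := by rw [hc]; push_cast; ring
    have h4 : (c : ℂ) * ζ z ^ 2 = 0 := by
      simp only [hF] at h2
      have : ((1 - r) / (1 + r) : ℂ) ^ 2 = 1 - 4 * r / (1 + r) ^ 2 := by
        field_simp
        ring
      rw [this, ← h3] at h2
      linear_combination -h2
    have h5 : ζ z = 0 := by
      have hc' : (c : ℂ) ≠ 0 := by exact_mod_cast hc0.ne'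
      simpa [hc'] using h4
    have := hζre z hz
    rw [h5] at this
    exact lt_irrefl _ this

/-- The lower bound of the growth theorem for univalent functions. -/
theorem koebe_growth_lower {f : ℂ → ℂ} (hf : DifferentiableOn ℂ f (ball 0 1))
    (hinj : InjOn f (ball 0 1)) {z : ℂ} (hz : z ∈ ball (0 : ℂ) 1) :
    ‖deriv f 0‖ * ‖z‖ / (1 + ‖z‖) ^ 2 ≤ ‖f z - f 0‖ := by
  rcases eq_or_ne z 0 with rfl | hz0
  · simp
  have hr : 0 < ‖z‖ := norm_pos_iff.2 hz0
  have hr' : (‖z‖ : ℂ) ≠ 0 := by exact_mod_cast hr.ne'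
  obtain ⟨φ, hφ, hmaps, hφinj, hφ0, hφd, hφne⟩ := exists_slit_map hr (mem_ball_zero_iff.1 hz)
  set u : ℂ := z / ‖z‖ with hu
  have hu1 : ‖u‖ = 1 := by simp [hu, hr.ne']
  have hu0 : u ≠ 0 := norm_ne_zero_iff.1 (by simp [hu1])
  have huz : u * ‖z‖ = z := div_mul_cancel₀ z hr'
  have hmem : ∀ x ∈ ball (0 : ℂ) 1, u * φ x ∈ ball (0 : ℂ) 1 := fun x hx => by
    simpa [hu1] using hmaps hx
  have hball : ball (0 : ℂ) 1 ∈ 𝓝 (0 : ℂ) := ball_mem_nhds _ one_pos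
  have hd : HasDerivAt (fun x => f (u * φ x) - f 0) (deriv f 0 * (u * deriv φ 0)) 0 := by
    refine HasDerivAt.sub_const _ (HasDerivAt.comp (h₂ := f) (h := fun x => u * φ x) 0 ?_
      ((hφ.differentiableAt hball).hasDerivAt.const_mul u))
    simpa [hφ0] using (hf.differentiableAt hball).hasDerivAt
  have key := koebe_quarter (f := fun x => f (u * φ x) - f 0) (w := f z - f 0)
    ((hf.comp (hφ.const_mul u) hmem).sub_const _) ?_ (by simp [hφ0]) ?_
  · rw [hd.deriv, hφd, norm_mul, norm_mul, hu1, Complex.norm_real, Real.norm_of_nonneg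
      (by positivity)] at key
    refine le_trans (le_of_eq ?_) key
    ring
  · intro x hx y hy h
    exact hφinj hx hy (mul_left_cancel₀ hu0 (hinj (hmem x hx) (hmem y hy) (sub_left_injective h)))
  · rintro ⟨x, hx, h⟩
    have h1 := hinj (hmem x hx) hz (sub_left_injective h)
    exact hφne x hx (mul_left_cancel₀ hu0 (h1.trans huz.symm))

lemma norm_mul_norm_deriv_le {f : ℂ → ℂ} (hf : DifferentiableOn ℂ f (ball 0 1))
    (hinj : InjOn f (ball 0 1)) {z : ℂ} (hz : z ∈ ball (0 : ℂ) 1) :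
    ‖z‖ * (1 - ‖z‖) * ‖deriv f z‖ ≤ (1 + ‖z‖) * ‖f z - f 0‖ := by
  have hz1 : ‖z‖ < 1 := mem_ball_zero_iff.1 hz
  set T : ℂ → ℂ := fun x => (x + z) / (1 + starRingEnd ℂ z * x) with hT
  have hne : ∀ x ∈ ball (0 : ℂ) 1, 1 + starRingEnd ℂ z * x ≠ 0 := fun x hx h => by
    have h1 : ‖starRingEnd ℂ z * x‖ = 1 := by
      rw [show starRingEnd ℂ z * x = -1 by linear_combination h]
      simp
    rw [norm_mul, Complex.norm_conj] at h1
    nlinarith [mem_ball_zero_iff.1 hx, norm_nonneg x, norm_nonneg z]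
  have hTd : ∀ x ∈ ball (0 : ℂ) 1,
      HasDerivAt T ((1 - starRingEnd ℂ z * z) / (1 + starRingEnd ℂ z * x) ^ 2) x := fun x hx => by
    refine (((hasDerivAt_id' x).add_const z).fun_div
      (((hasDerivAt_id' x).const_mul (starRingEnd ℂ z)).const_add 1) (hne x hx)).congr_deriv ?_
    ring
  have hzz : starRingEnd ℂ z * z = (‖z‖ ^ 2 : ℝ) := by
    rw [mul_comm, Complex.mul_conj, Complex.normSq_eq_norm_sq]
  have hmaps : MapsTo T (ball 0 1) (ball 0 1) := fun x hx => by
    rw [mem_ball_zero_iff, norm_div, div_lt_one (norm_pos_iff.2 (hne x hx)),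
      ← sq_lt_sq₀ (norm_nonneg _) (norm_nonneg _), ← Complex.normSq_eq_norm_sq,
      ← Complex.normSq_eq_norm_sq]
    have h1 : Complex.normSq (1 + starRingEnd ℂ z * x) - Complex.normSq (x + z)
        = (1 - Complex.normSq z) * (1 - Complex.normSq x) := by
      simp [Complex.normSq_apply]
      ring
    have h2 : 0 < (1 - Complex.normSq z) * (1 - Complex.normSq x) := by
      rw [Complex.normSq_eq_norm_sq, Complex.normSq_eq_norm_sq]
      have hx1 := mem_ball_zero_iff.1 hx
      refine mul_pos ?_ ?_ <;> nlinarith [norm_nonneg x, norm_nonneg z]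
    linarith
  have hzz1 : (1 - starRingEnd ℂ z * z) ≠ 0 := by
    rw [hzz]
    have : (1 - ‖z‖ ^ 2 : ℝ) ≠ 0 := by nlinarith [norm_nonneg z]
    exact_mod_cast this
  have hTinj : InjOn T (ball 0 1) := fun x hx y hy h => by
    simp only [hT] at h
    rw [div_eq_div_iff (hne x hx) (hne y hy)] at h
    exact mul_left_cancel₀ hzz1 (by linear_combination h)
  have hmem0 : (0 : ℂ) ∈ ball (0 : ℂ) 1 := by simp
  have hT0 : T 0 = z := by simp [hT]
  have hTz : T (-z) = 0 := by simp [hT]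
  have hd : HasDerivAt (f ∘ T) (deriv f z * (1 - starRingEnd ℂ z * z)) 0 := by
    refine HasDerivAt.comp 0 ?_ ((hTd 0 hmem0).congr_deriv (by simp))
    rw [hT0]
    exact (hf.differentiableAt (isOpen_ball.mem_nhds hz)).hasDerivAt
  have key := koebe_growth_lower (f := f ∘ T) (z := -z)
    (hf.comp (fun x hx => (hTd x hx).differentiableAt.differentiableWithinAt) hmaps)
    (hinj.comp hTinj hmaps) (by simpa using hz1)
  have hnorm : ‖1 - starRingEnd ℂ z * z‖ = 1 - ‖z‖ ^ 2 := by
    rw [hzz, ← Complex.ofReal_one, ← Complex.ofReal_sub, Complex.norm_real, Real.norm_of_nonneg]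
    nlinarith [norm_nonneg z]
  rw [hd.deriv, norm_mul, hnorm, norm_neg, Function.comp_apply, Function.comp_apply, hTz, hT0,
    norm_sub_rev] at key
  have hpos : 0 < 1 + ‖z‖ := by positivity
  calc ‖z‖ * (1 - ‖z‖) * ‖deriv f z‖
      = (1 + ‖z‖) * (‖deriv f z‖ * (1 - ‖z‖ ^ 2) * ‖z‖ / (1 + ‖z‖) ^ 2) := by
        field_simp
        ring
    _ ≤ _ := by gcongr

/-- The upper bound of the growth theorem for univalent functions. -/
theorem koebe_growth_upper {f : ℂ → ℂ} (hf : DifferentiableOn ℂ f (ball 0 1))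
    (hinj : InjOn f (ball 0 1)) (h0 : f 0 = 0) {z : ℂ} (hz : z ∈ ball (0 : ℂ) 1) :
    ‖f z‖ ≤ ‖deriv f 0‖ * ‖z‖ / (1 - ‖z‖) ^ 2 := by
  rcases eq_or_ne z 0 with rfl | hz0
  · simp [h0]
  have hr : 0 < ‖z‖ := norm_pos_iff.2 hz0
  have hr1 : ‖z‖ < 1 := mem_ball_zero_iff.1 hz
  have hr' : (‖z‖ : ℂ) ≠ 0 := by exact_mod_cast hr.ne'
  set u : ℂ := z / ‖z‖ with hu
  have hu1 : ‖u‖ = 1 := by simp [hu, hr.ne']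
  have hu0 : u ≠ 0 := norm_ne_zero_iff.1 (by simp [hu1])
  have huz : ‖z‖ * u = z := mul_div_cancel₀ z hr'
  have hball : ball (0 : ℂ) 1 ∈ 𝓝 (0 : ℂ) := ball_mem_nhds _ one_pos
  have hD : DifferentiableOn ℂ (dslope f 0) (ball 0 1) :=
    (Complex.differentiableOn_dslope hball).2 hf
  have hDval : ∀ t : ℝ, 0 < t → ‖dslope f 0 (t * u)‖ = ‖f (t * u)‖ / t := fun t ht => by
    have : (t * u : ℂ) ≠ 0 := mul_ne_zero (by exact_mod_cast ht.ne') hu0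
    rw [dslope_of_ne _ this, slope_def_field, h0, sub_zero, sub_zero, norm_div, norm_mul, hu1,
      mul_one, Complex.norm_of_nonneg ht.le]
  have hmem : ∀ t ∈ Icc 0 ‖z‖, (t * u : ℂ) ∈ ball (0 : ℂ) 1 := fun t ht => by
    rw [mem_ball_zero_iff, norm_mul, hu1, mul_one, Complex.norm_of_nonneg ht.1]
    exact ht.2.trans_lt hr1
  set g : ℝ → ℝ := fun t => ‖dslope f 0 (t * u)‖ ^ 2 * (1 - t) ^ 4 with hg
  have hder : ∀ t ∈ Ioo 0 ‖z‖, HasDerivAt g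
      (2 * inner ℝ (f (t * u)) (deriv f (t * u) * u) * ((1 - t) ^ 4 / t ^ 2) + ‖f (t * u)‖ ^ 2 *
        (-(4 * t + 2 * (1 - t)) * (1 - t) ^ 3 / t ^ 3)) t := fun t ht => by
    have ht0 := ht.1
    have h1 : HasDerivAt (fun t : ℝ => f (t * u)) (deriv f (t * u) * u) t := by
      have hfd := (hf.differentiableAt (isOpen_ball.mem_nhds
        (hmem t (Ioo_subset_Icc_self ht)))).hasDerivAt
      have hlin : HasDerivAt (fun x : ℂ => x * u) u (t : ℂ) := by
        simpa using (hasDerivAt_id' (t : ℂ)).mul_const u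
      exact (HasDerivAt.comp (h₂ := f) (t : ℂ) hfd hlin).comp_ofReal
    have h2 : HasDerivAt (fun t : ℝ => (1 - t) ^ 4 / t ^ 2)
        (-(4 * t + 2 * (1 - t)) * (1 - t) ^ 3 / t ^ 3) t := by
      refine ((((hasDerivAt_id' t).const_sub 1).fun_pow 4).fun_div
        ((hasDerivAt_id' t).fun_pow 2) (by positivity)).congr_deriv ?_
      field_simp
      ring
    refine (h1.norm_sq.fun_mul h2).congr_of_eventuallyEq ?_
    filter_upwards [lt_mem_nhds ht0] with x hx
    simp only [hg, hDval x hx]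
    ring
  have hcont : ContinuousOn g (Icc 0 ‖z‖) := by
    have h1 : ContinuousOn (fun t : ℝ => dslope f 0 (t * u)) (Icc 0 ‖z‖) :=
      hD.continuousOn.comp (by fun_prop) hmem
    exact (h1.norm.pow 2).mul (by fun_prop)
  have hanti : AntitoneOn g (Icc 0 ‖z‖) := by
    refine antitoneOn_of_deriv_nonpos (convex_Icc _ _) hcont ?_ ?_
    · rw [interior_Icc]
      exact fun t ht => (hder t ht).differentiableAt.differentiableWithinAt
    · rw [interior_Icc]
      intro t ht
      rw [(hder t ht).deriv]
      have ht0 := ht.1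
      have ht1 : 0 < 1 - t := by linarith [ht.2]
      have h1 := norm_mul_norm_deriv_le hf hinj (hmem t (Ioo_subset_Icc_self ht))
      rw [norm_mul, hu1, mul_one, Complex.norm_of_nonneg ht0.le, h0, sub_zero] at h1
      have h2 : inner ℝ (f (t * u)) (deriv f (t * u) * u) ≤
          ‖f (t * u)‖ * ((1 + t) * ‖f (t * u)‖ / (t * (1 - t))) := by
        refine (real_inner_le_norm _ _).trans ?_
        rw [norm_mul, hu1, mul_one]
        gcongr
        rw [le_div_iff₀ (by positivity)]
        linarith
      have h3 := mul_le_mul_of_nonneg_right h2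
        (by positivity : 0 ≤ 2 * ((1 - t) ^ 4 / t ^ 2))
      have h4 : ‖f (t * u)‖ * ((1 + t) * ‖f (t * u)‖ / (t * (1 - t))) *
          (2 * ((1 - t) ^ 4 / t ^ 2)) + ‖f (t * u)‖ ^ 2 *
          (-(4 * t + 2 * (1 - t)) * (1 - t) ^ 3 / t ^ 3) = 0 := by
        field_simp
        ring
      linarith
  have hfin := hanti (left_mem_Icc.2 hr.le) (right_mem_Icc.2 hr.le) hr.le
  simp only [hg] at hfin
  rw [hDval _ hr, huz, Complex.ofReal_zero, zero_mul, dslope_same] at hfin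
  have h1r : 0 < 1 - ‖z‖ := sub_pos.2 hr1
  have h5 : (‖f z‖ / ‖z‖ * (1 - ‖z‖) ^ 2) ^ 2 ≤ ‖deriv f 0‖ ^ 2 := by
    refine le_trans (le_of_eq (by ring)) (hfin.trans (le_of_eq (by ring)))
  have h6 := (sq_le_sq₀ (by positivity) (norm_nonneg _)).1 h5
  rw [le_div_iff₀ (by positivity)]
  calc ‖f z‖ * (1 - ‖z‖) ^ 2 = ‖f z‖ / ‖z‖ * (1 - ‖z‖) ^ 2 * ‖z‖ := by field_simp
    _ ≤ _ := by gcongr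

theorem koebe_annulus_subset_image
    (a R1 R2 : ℝ) (ha : 0 < a) (hR1 : R1 ∈ Set.Ioo (0:ℝ) 1) (hR2 : R2 ∈ Set.Ioo (0:ℝ) 1)
    (hratio : 6 ≤ R2 / R1) :
    ∃ r1 r2 : ℝ, 0 < r1 ∧ r1 < r2 ∧ r2 < a / 4 ∧ (R2 / R1) / 6 < r2 / r1 ∧
      ∀ f : ℂ → ℂ, DifferentiableOn ℂ f (Metric.ball 0 1) →
        Set.InjOn f (Metric.ball 0 1) → f 0 = 0 → ‖deriv f 0‖ = a →
        {w : ℂ | r1 ≤ ‖w‖ ∧ ‖w‖ ≤ r2} ⊆ f '' {z : ℂ | R1 ≤ ‖z‖ ∧ ‖z‖ ≤ R2} := by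
  obtain ⟨h10, h11⟩ := hR1
  obtain ⟨h20, h21⟩ := hR2
  have hR : 6 * R1 ≤ R2 := (le_div_iff₀ h10).1 hratio
  have h1 : 0 < 1 - R1 := sub_pos.2 h11
  have hr1 : 0 < a * R1 / (1 - R1) ^ 2 := by positivity
  have hlt4 : a * R2 / (1 + R2) ^ 2 < a / 4 := by
    rw [div_lt_div_iff₀ (by positivity) (by norm_num)]
    nlinarith [mul_pos ha (pow_pos (sub_pos.2 h21) 2)]
  have hq : R2 / R1 / 6 < a * R2 / (1 + R2) ^ 2 / (a * R1 / (1 - R1) ^ 2) := by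
    have e : a * R2 / (1 + R2) ^ 2 / (a * R1 / (1 - R1) ^ 2)
        = R2 / R1 * ((1 - R1) ^ 2 / (1 + R2) ^ 2) := by field_simp
    rw [e, div_eq_mul_inv _ (6 : ℝ)]
    refine mul_lt_mul_of_pos_left ?_ (by positivity)
    rw [lt_div_iff₀ (by positivity)]
    nlinarith
  refine ⟨a * R1 / (1 - R1) ^ 2, a * R2 / (1 + R2) ^ 2, hr1, ?_, hlt4, hq, ?_⟩
  · exact (one_lt_div hr1).1 (((one_le_div (by norm_num)).2 hratio).trans_lt hq)
  rintro f hf hinj h0 hfa w ⟨hw1, hw2⟩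
  obtain ⟨z, hz, rfl⟩ : w ∈ f '' ball 0 1 := by
    by_contra hw
    have := koebe_quarter hf hinj h0 hw
    rw [hfa] at this
    linarith
  have hz1 := mem_ball_zero_iff.1 hz
  refine ⟨z, ⟨?_, ?_⟩, rfl⟩
  · by_contra! hlt
    have hup := hw1.trans (koebe_growth_upper hf hinj h0 hz)
    rw [hfa] at hup
    refine hup.not_gt ?_
    have : (1 - R1) ^ 2 ≤ (1 - ‖z‖) ^ 2 := by gcongr
    exact (div_lt_div_of_pos_right (mul_lt_mul_of_pos_left hlt ha) (by positivity)).trans_le'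
      (by gcongr)
  · by_contra! hlt
    have hlow := (koebe_growth_lower hf hinj hz).trans (by simpa [h0] using hw2)
    rw [hfa, div_le_div_iff₀ (by positivity) (by positivity)] at hlow
    have hprod : 0 < 1 - R2 * ‖z‖ := by nlinarith
    nlinarith [mul_pos ha (mul_pos (sub_pos.2 hlt) hprod)]
end

section
/- For every $a > 0$ and every $0 < r_1 < r_2$ with $r_2 < a/4$ and $r_2/r_1 \ge 12$, there exist $R_1, R_2 \in (0,1)$ with $R_1 < R_2$ and $R_2/R_1 > (r_2/r_1)/12$ such that for every univalent analytic function $f$ on the unit disc with $f(0)=0$ and $|f'(0)|=a$, the annulus $\{z : R_1 \le |z| \le R_2\}$ is contained in $f^{-1}(\{w : r_1 \le |w| \le r_2\})$. -/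
open Set Metric

/-- A nonvanishing holomorphic function on a disc is a constant multiple of an exponential. -/
lemma exists_eq_mul_exp_of_ne_zero {g : ℂ → ℂ} {R : ℝ} (hR : 0 < R)
    (hg : DifferentiableOn ℂ g (ball 0 R)) (hne : ∀ z ∈ ball (0 : ℂ) R, g z ≠ 0) :
    ∃ p : ℂ → ℂ, DifferentiableOn ℂ p (ball 0 R) ∧ p 0 = 0 ∧
      ∀ z ∈ ball (0 : ℂ) R, g z = g 0 * Complex.exp (p z) := by
  have h0 : (0 : ℂ) ∈ ball (0 : ℂ) R := mem_ball_self hR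
  obtain ⟨P, hP⟩ := ((hg.deriv isOpen_ball).div hg hne).isExactOn_ball
  have hgd : ∀ z ∈ ball (0 : ℂ) R, HasDerivAt g (deriv g z) z := fun z hz =>
    (hg.differentiableAt (isOpen_ball.mem_nhds hz)).hasDerivAt
  have hq : ∀ z ∈ ball (0 : ℂ) R,
      HasDerivAt (fun z => g z * Complex.exp (-(P z - P 0))) 0 z := by
    intro z hz
    have h := (hgd z hz).mul (((hP z hz).sub_const (P 0)).neg.cexp)
    refine h.congr_deriv ?_
    have := hne z hz
    simp only [Pi.div_apply, Pi.neg_apply]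
    field_simp
    ring
  refine ⟨fun z => P z - P 0, fun z hz =>
    ((hP z hz).sub_const (P 0)).differentiableAt.differentiableWithinAt, by simp, ?_⟩
  intro z hz
  have hconst := isOpen_ball.is_const_of_deriv_eq_zero (convex_ball (0 : ℂ) R).isPreconnected
    (fun w hw => (hq w hw).differentiableAt.differentiableWithinAt)
    (fun w hw => (hq w hw).deriv) hz h0
  simp only [sub_self, neg_zero, Complex.exp_zero, mul_one] at hconst
  rw [← hconst, mul_assoc, ← Complex.exp_add]
  simp

/-- A nonvanishing holomorphic function on a disc, equal to `1` at the centre, has a holomorphic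
square root there. -/
lemma exists_sq_eq_of_ne_zero {g : ℂ → ℂ} {R : ℝ} (hR : 0 < R)
    (hg : DifferentiableOn ℂ g (ball 0 R)) (hne : ∀ z ∈ ball (0 : ℂ) R, g z ≠ 0)
    (hg0 : g 0 = 1) :
    ∃ s : ℂ → ℂ, DifferentiableOn ℂ s (ball 0 R) ∧ s 0 = 1 ∧ deriv g 0 = 2 * deriv s 0 ∧
      ∀ z ∈ ball (0 : ℂ) R, s z ^ 2 = g z := by
  obtain ⟨p, hp, hp0, hgp⟩ := exists_eq_mul_exp_of_ne_zero hR hg hne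
  have hs : DifferentiableOn ℂ (fun z => Complex.exp (p z / 2)) (ball 0 R) := by fun_prop
  have hsq : ∀ z ∈ ball (0 : ℂ) R, Complex.exp (p z / 2) ^ 2 = g z := by
    intro z hz
    rw [hgp z hz, hg0, one_mul, ← Complex.exp_nat_mul]
    congr 1
    push_cast
    ring
  refine ⟨_, hs, by simp [hp0], ?_, hsq⟩
  have hd := (hs.differentiableAt (ball_mem_nhds 0 hR)).hasDerivAt.pow 2
  have he : (fun z => Complex.exp (p z / 2)) ^ 2 =ᶠ[nhds 0] g := by
    filter_upwards [ball_mem_nhds (0 : ℂ) hR] with z hz using hsq z hz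
  rw [← he.deriv_eq, hd.deriv]
  simp [hp0]

/-- A crude form of the Bieberbach–Eilenberg theorem. -/
lemma norm_deriv_le_of_mul_ne_one {B : ℂ → ℂ} (hB : DifferentiableOn ℂ B (ball 0 1))
    (hB0 : B 0 = 0) (hne : ∀ z ∈ ball (0 : ℂ) 1, ∀ u ∈ ball (0 : ℂ) 1, B z * B u ≠ 1) :
    ‖deriv B 0‖ ≤ 5 / 2 := by
  have hsub : closedBall (0 : ℂ) (9 / 10) ⊆ ball 0 1 := closedBall_subset_ball (by norm_num)
  have hcl : ∀ {h : ℂ → ℂ}, DifferentiableOn ℂ h (ball 0 1) →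
      DiffContOnCl ℂ h (ball 0 (9 / 10)) := fun hh => by
    apply DifferentiableOn.diffContOnCl
    rw [closure_ball _ (by norm_num)]
    exact hh.mono hsub
  obtain ⟨z₀, hz₀, hmax⟩ := (isCompact_closedBall (0 : ℂ) (9 / 10)).exists_isMaxOn
    ⟨0, mem_closedBall_self (by norm_num)⟩ (hB.continuousOn.mono hsub).norm
  have hM : ∀ z ∈ sphere (0 : ℂ) (9 / 10), ‖B z‖ ≤ ‖B z₀‖ := fun z hz =>
    hmax (sphere_subset_closedBall hz)
  have hb := Complex.norm_deriv_le_of_forall_mem_sphere_norm_le (by norm_num) (hcl hB) hM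
  obtain ⟨s, hs, -, hsd, hsq⟩ := exists_sq_eq_of_ne_zero one_pos
    (g := fun z => 1 - B z₀ * B z) (by fun_prop)
    (fun z hz h => hne z₀ (hsub hz₀) z hz (sub_eq_zero.mp h).symm) (by simp [hB0])
  have hsb := Complex.norm_deriv_le_of_forall_mem_sphere_norm_le (C := √(1 + ‖B z₀‖ ^ 2))
    (by norm_num) (hcl hs) (fun z hz => by
      apply Real.le_sqrt_of_sq_le
      rw [← norm_pow, hsq z (hsub (sphere_subset_closedBall hz))]
      refine (norm_sub_le _ _).trans ?_
      rw [norm_one, norm_mul, sq]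
      gcongr
      exact hM z hz)
  have hBd : HasDerivAt B (deriv B 0) 0 :=
    (hB.differentiableAt (ball_mem_nhds 0 one_pos)).hasDerivAt
  rw [((hBd.const_mul (B z₀)).const_sub 1).deriv] at hsd
  have hsn : ‖B z₀‖ * ‖deriv B 0‖ = 2 * ‖deriv s 0‖ := by
    simpa using congrArg norm hsd
  set M := ‖B z₀‖
  set b := ‖deriv B 0‖
  have hq : (√(1 + M ^ 2)) ^ 2 = 1 + M ^ 2 := Real.sq_sqrt (by positivity)
  rw [le_div_iff₀ (by norm_num)] at hb hsb
  have h1 : (M * b * (9 / 20)) ^ 2 ≤ 1 + M ^ 2 := by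
    rw [← hq, hsn]
    exact pow_le_pow_left₀ (by positivity) (by linarith) 2
  by_contra! hlt
  have h2 : (9 / 4) ^ 2 ≤ M ^ 2 := pow_le_pow_left₀ (by norm_num) (by linarith) 2
  have h3 : (5 / 2) ^ 2 ≤ b ^ 2 := pow_le_pow_left₀ (by norm_num) hlt.le 2
  nlinarith [mul_le_mul_of_nonneg_left h3 (sq_nonneg M)]

/-- A crude form of the Koebe quarter theorem. -/
lemma norm_deriv_le_of_forall_ne {f : ℂ → ℂ} (hf : DifferentiableOn ℂ f (ball 0 1))
    (hinj : InjOn f (ball 0 1)) (hf0 : f 0 = 0) {w : ℂ}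
    (hw : ∀ z ∈ ball (0 : ℂ) 1, f z ≠ w) : ‖deriv f 0‖ ≤ 10 * ‖w‖ := by
  have h0 : (0 : ℂ) ∈ ball (0 : ℂ) 1 := mem_ball_self one_pos
  have hw0 : w ≠ 0 := fun h => hw 0 h0 (by rw [hf0, h])
  obtain ⟨s, hs, hs0, hsd, hsq⟩ := exists_sq_eq_of_ne_zero one_pos
    (g := fun z => 1 - f z / w) (by fun_prop)
    (fun z hz h => hw z hz ((div_eq_one_iff_eq hw0).mp (sub_eq_zero.mp h).symm)) (by simp [hf0])
  have hfs : ∀ z ∈ ball (0 : ℂ) 1, ∀ u ∈ ball (0 : ℂ) 1, s z ^ 2 = s u ^ 2 → z = u := by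
    intro z hz u hu h
    rw [hsq z hz, hsq u hu, sub_right_inj, div_left_inj' hw0] at h
    exact hinj hz hu h
  have hne : ∀ z ∈ ball (0 : ℂ) 1, ∀ u ∈ ball (0 : ℂ) 1, s z + s u ≠ 0 := by
    intro z hz u hu h
    have hzu : z = u := hfs z hz u hu (by rw [eq_neg_of_add_eq_zero_left h, neg_sq])
    subst hzu
    have hsz : s z = 0 := by linear_combination h / 2
    refine hw z hz ((div_eq_one_iff_eq hw0).mp ?_)
    linear_combination hsq z hz - s z * hsz
  have hne1 : ∀ z ∈ ball (0 : ℂ) 1, s z + 1 ≠ 0 := fun z hz => by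
    simpa [hs0] using hne z hz 0 h0
  have hB := norm_deriv_le_of_mul_ne_one (B := fun z => (s z - 1) / (s z + 1))
    ((hs.sub_const 1).div (hs.add_const 1) hne1) (by simp [hs0])
    (fun z hz u hu h => by
      have h1 := hne1 z hz
      have h2 := hne1 u hu
      field_simp at h
      exact hne z hz u hu (by linear_combination -h / 2))
  have hsD : HasDerivAt s (deriv s 0) 0 :=
    (hs.differentiableAt (ball_mem_nhds 0 one_pos)).hasDerivAt
  have hfD : HasDerivAt f (deriv f 0) 0 :=
    (hf.differentiableAt (ball_mem_nhds 0 one_pos)).hasDerivAt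
  rw [((hfD.div_const w).const_sub 1).deriv] at hsd
  have hBD := ((hsD.sub_const 1).div (hsD.add_const 1) (hne1 0 h0)).deriv
  have hB' : deriv (fun z => (s z - 1) / (s z + 1)) 0 = -deriv f 0 / (4 * w) := by
    refine hBD.trans ?_
    rw [hs0]
    have : deriv f 0 = -2 * deriv s 0 * w := by
      field_simp at hsd
      linear_combination -hsd
    rw [this]
    field_simp
    ring
  rw [hB', norm_div, norm_neg, norm_mul, Complex.norm_ofNat,
    div_le_iff₀ (mul_pos (by norm_num) (norm_pos_iff.mpr hw0))] at hB
  linarith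

/-- A crude global lower growth estimate for univalent functions on the unit disc. -/
lemma norm_deriv_mul_norm_le_of_injOn {f : ℂ → ℂ} (hf : DifferentiableOn ℂ f (ball 0 1))
    (hinj : InjOn f (ball 0 1)) (hf0 : f 0 = 0) {z : ℂ} (hz : z ∈ ball (0 : ℂ) 1) :
    ‖deriv f 0‖ * ‖z‖ ≤ 10 * ‖f z‖ := by
  rcases eq_or_ne z 0 with rfl | hz0
  · simp
  have hz1 : ‖z‖ < 1 := mem_ball_zero_iff.mp hz
  have hmaps : MapsTo (fun u => z * u) (ball (0 : ℂ) 1) (ball 0 1) := by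
    intro u hu
    rw [mem_ball_zero_iff] at hu ⊢
    rw [norm_mul]
    exact mul_lt_one_of_nonneg_of_lt_one_left (norm_nonneg _) hz1 hu.le
  have hfD : HasDerivAt f (deriv f 0) (z * 0) := by
    rw [mul_zero]
    exact (hf.differentiableAt (ball_mem_nhds 0 one_pos)).hasDerivAt
  have hD : deriv (fun u => f (z * u)) 0 = deriv f 0 * z := by
    have := hfD.comp (0 : ℂ) ((hasDerivAt_id (0 : ℂ)).const_mul z)
    rw [mul_one] at this
    exact this.deriv
  rw [← norm_mul, ← hD]
  refine norm_deriv_le_of_forall_ne (hf.comp (by fun_prop) hmaps) ?_ (by simp [hf0]) ?_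
  · intro u hu v hv h
    exact mul_left_cancel₀ hz0 (hinj (hmaps hu) (hmaps hv) h)
  · intro u hu h
    have hu1 : u = 1 := mul_left_cancel₀ hz0 ((hinj (hmaps hu) hz h).trans (mul_one z).symm)
    simp [hu1] at hu

/-- Near the centre of the disc, a univalent function fixing `0` is comparable to its
linearization, with absolute constants. -/
lemma norm_mem_Icc_of_injOn {f : ℂ → ℂ} (hf : DifferentiableOn ℂ f (ball 0 1))
    (hinj : InjOn f (ball 0 1)) (hf0 : f 0 = 0) (hd : deriv f 0 ≠ 0) {z : ℂ}
    (hz : ‖z‖ ≤ 1 / 8) :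
    ‖f z‖ ∈ Icc (‖deriv f 0‖ * ‖z‖ / 2) (2 * (‖deriv f 0‖ * ‖z‖)) := by
  have hk : DifferentiableOn ℂ (dslope f 0) (ball 0 1) :=
    (Complex.differentiableOn_dslope (ball_mem_nhds 0 one_pos)).mpr hf
  have hfk : ∀ u, f u = u * dslope f 0 u := fun u => by
    simpa [hf0] using (sub_smul_dslope f 0 u).symm
  have hk0 : dslope f 0 0 = deriv f 0 := dslope_same f 0
  have hdpos : 0 < ‖deriv f 0‖ := norm_pos_iff.mpr hd
  have hlow : ∀ u ∈ ball (0 : ℂ) 1, ‖deriv f 0‖ ≤ 10 * ‖dslope f 0 u‖ := by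
    intro u hu
    rcases eq_or_ne u 0 with rfl | hu0
    · rw [hk0]
      linarith
    have h := norm_deriv_mul_norm_le_of_injOn hf hinj hf0 hu
    rw [hfk u, norm_mul] at h
    exact le_of_mul_le_mul_right (by linarith) (norm_pos_iff.mpr hu0)
  obtain ⟨p, hp, hp0, hkp⟩ := exists_eq_mul_exp_of_ne_zero one_pos hk (fun u hu h => by
    have := hlow u hu
    rw [h, norm_zero] at this
    linarith)
  have hre : ∀ u ∈ ball (0 : ℂ) 1, -(p u).re ≤ Real.log 10 := by
    intro u hu
    have h := hlow u hu
    rw [hkp u hu, hk0, norm_mul, Complex.norm_exp] at h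
    have h1 : 1 ≤ 10 * Real.exp (p u).re := le_of_mul_le_mul_left (by linarith) hdpos
    rw [Real.le_log_iff_exp_le (by norm_num), Real.exp_neg, inv_le_iff_one_le_mul₀ (by positivity)]
    exact h1
  have hz1 : z ∈ ball (0 : ℂ) 1 := mem_ball_zero_iff.mpr (by linarith)
  have hbc := Complex.borelCaratheodory_zero (f := fun u => -p u)
    (Real.log_pos (by norm_num : (1 : ℝ) < 10)) hp.neg (fun u hu => hre u hu) one_pos hz1
    (by simp [hp0])
  have hlog : Real.log 10 * 2 ≤ Real.log 2 * 7 := by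
    have h : Real.log (10 ^ 2) ≤ Real.log (2 ^ 7) :=
      Real.log_le_log (by norm_num) (by norm_num)
    rw [Real.log_pow, Real.log_pow] at h
    push_cast at h
    linarith
  have hL : 0 < Real.log 10 := Real.log_pos (by norm_num)
  have hpn : ‖p z‖ ≤ Real.log 2 := by
    rw [norm_neg] at hbc
    refine hbc.trans ?_
    rw [div_le_iff₀ (by linarith)]
    nlinarith [Real.log_pos (by norm_num : (1 : ℝ) < 2), norm_nonneg z]
  have hrep := abs_le.mp ((Complex.abs_re_le_norm (p z)).trans hpn)
  have hup : Real.exp (p z).re ≤ 2 := by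
    rw [← Real.le_log_iff_exp_le (by norm_num)]
    exact hrep.2
  have hdn : 1 / 2 ≤ Real.exp (p z).re := by
    have h := Real.exp_le_exp.mpr hrep.1
    rw [Real.exp_neg, Real.exp_log (by norm_num)] at h
    linarith
  have hfz : ‖f z‖ = ‖deriv f 0‖ * ‖z‖ * Real.exp (p z).re := by
    rw [hfk z, hkp z hz1, hk0, norm_mul, norm_mul, Complex.norm_exp]
    ring
  have hnn : 0 ≤ ‖deriv f 0‖ * ‖z‖ := by positivity
  rw [hfz]
  constructor <;> nlinarith

theorem koebe_annulus_subset_preimage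
    (a r1 r2 : ℝ) (ha : 0 < a) (hr1 : 0 < r1) (hr12 : r1 < r2)
    (hr2 : r2 < a / 4) (hratio : 12 ≤ r2 / r1) :
    ∃ R1 R2 : ℝ, R1 ∈ Set.Ioo (0:ℝ) 1 ∧ R2 ∈ Set.Ioo (0:ℝ) 1 ∧ R1 < R2 ∧
      (r2 / r1) / 12 < R2 / R1 ∧
      ∀ f : ℂ → ℂ, DifferentiableOn ℂ f (Metric.ball 0 1) →
        Set.InjOn f (Metric.ball 0 1) → f 0 = 0 → ‖deriv f 0‖ = a →
        {z : ℂ | R1 ≤ ‖z‖ ∧ ‖z‖ ≤ R2} ⊆ f ⁻¹' {w : ℂ | r1 ≤ ‖w‖ ∧ ‖w‖ ≤ r2} := by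
  have hr2pos : 0 < r2 := hr1.trans hr12
  have hr : 12 * r1 ≤ r2 := (le_div_iff₀ hr1).mp hratio
  have hR : 2 * r1 / a < r2 / (2 * a) := by
    rw [div_lt_div_iff₀ ha (by positivity)]
    nlinarith
  have hR2 : r2 / (2 * a) < 1 / 8 := by
    rw [div_lt_div_iff₀ (by positivity) (by norm_num)]
    linarith
  refine ⟨2 * r1 / a, r2 / (2 * a), ⟨by positivity, by linarith⟩, ⟨by positivity, by linarith⟩,
    hR, ?_, ?_⟩
  · have h : r2 / (2 * a) / (2 * r1 / a) = r2 / r1 / 4 := by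
      field_simp
      norm_num
    rw [h]
    linarith
  · rintro f hf hinj hf0 hfa z ⟨hz1, hz2⟩
    have hd : deriv f 0 ≠ 0 := norm_pos_iff.mp (hfa ▸ ha)
    obtain ⟨h1, h2⟩ := norm_mem_Icc_of_injOn hf hinj hf0 hd (hz2.trans hR2.le)
    rw [hfa] at h1 h2
    rw [div_le_iff₀ ha] at hz1
    rw [le_div_iff₀ (by positivity)] at hz2
    exact ⟨by linarith, by linarith⟩
end

section
/- Let $\kappa > 0$ and define $p_t(x,y) = \sum_{n=0}^\infty \frac{\sin(y/2)^{8/\kappa}\, C_n^{(4/\kappa)}(\cos(x/2))\, C_n^{(4/\kappa)}(\cos(y/2))}{2 \langle C_n^{(4/\kappa)}, C_n^{(4/\kappa)} \rangle}\, e^{-n(1 + \frac{\kappa}{8}n)t}$ for $x, y \in (0, 2\pi)$, where $C_n^{(\lambda)}$ are the Gegenbauer polynomials with index $\lambda = 4/\kappa$ and $\langle f, g\rangle = \int_{-1}^1 (1-u^2)^{4/\kappa - 1/2} f(u) g(u)\, du$. Then there exists $t_0 \ge 1$ and constants $0 < C_1 \le C_2 < \infty$ (depending only on $\kappa$) such that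 for all $t \ge t_0$ and all $x, y \in (0, 2\pi)$: $C_1 \sin(y/2)^{8/\kappa} \le p_t(x,y) \le C_2 \sin(y/2)^{8/\kappa}$. -/
open MeasureTheory Set Real

/-- Gegenbauer polynomials with index `lam`, defined by the standard recurrence
`(n+1) C_{n+1}(x) = 2(n+lam) x C_n(x) - (n+2 lam-1) C_{n-1}(x)`. -/
noncomputable def gegenbauer (lam : ℝ) : ℕ → ℝ → ℝ
  | 0, _ => 1
  | 1, x => 2 * lam * x
  | (n+2), x => (2 * ((n:ℝ) + 1 + lam) * x * gegenbauer lam (n+1) x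
      - ((n:ℝ) + 2 * lam) * gegenbauer lam n x) / ((n:ℝ) + 2)

/-- The squared norm `⟨C_n, C_n⟩` with weight `(1-u²)^{lam-1/2}` on `[-1,1]`. -/
noncomputable def gegenbauerNormSq (lam : ℝ) (n : ℕ) : ℝ :=
  ∫ u in (-1:ℝ)..1, (1 - u^2) ^ (lam - 1/2) * (gegenbauer lam n u) ^ 2

/-- The transition density `p_t(x,y)` of the radial Bessel-type diffusion. -/
noncomputable def radialDensity (κ t x y : ℝ) : ℝ :=
  ∑' n : ℕ,
    Real.sin (y/2) ^ (8/κ) * gegenbauer (4/κ) n (Real.cos (x/2)) *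
      gegenbauer (4/κ) n (Real.cos (y/2)) / (2 * gegenbauerNormSq (4/κ) n) *
      Real.exp (-(n:ℝ) * (1 + κ/8 * (n:ℝ)) * t)

theorem gegenbauer_zero (lam x : ℝ) : gegenbauer lam 0 x = 1 := by
  simp [gegenbauer]

theorem gegenbauer_one (lam x : ℝ) : gegenbauer lam 1 x = 2 * lam * x := by
  simp [gegenbauer]

theorem gegenbauer_add_two (lam : ℝ) (n : ℕ) (x : ℝ) :
    gegenbauer lam (n + 2) x = (2 * ((n : ℝ) + 1 + lam) * x * gegenbauer lam (n + 1) x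
      - ((n : ℝ) + 2 * lam) * gegenbauer lam n x) / ((n : ℝ) + 2) := by
  rw [gegenbauer]

theorem continuous_gegenbauer (lam : ℝ) (n : ℕ) : Continuous (gegenbauer lam n) := by
  induction n using Nat.twoStepInduction with
  | zero => exact continuous_const.congr fun x => (gegenbauer_zero lam x).symm
  | one => exact (continuous_const.mul continuous_id).congr fun x => (gegenbauer_one lam x).symm
  | more n h0 h1 =>
    rw [funext (gegenbauer_add_two lam n)]
    fun_prop

/-- A bound on one step of the Gegenbauer recurrence. -/
theorem abs_gegenbauer_step_le {lam a b p q : ℝ} (hlam : 0 < lam) (n : ℕ)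
    (ha : |a| ≤ p) (hb : |b| ≤ q) :
    |(2 * ((n : ℝ) + 1 + lam) * a - ((n : ℝ) + 2 * lam) * b) / ((n : ℝ) + 2)| ≤
      2 * (1 + lam) * p + (1 + lam) * q := by
  have hn : (0 : ℝ) ≤ n := n.cast_nonneg
  have hp : 0 ≤ p := (abs_nonneg a).trans ha
  have hq : 0 ≤ q := (abs_nonneg b).trans hb
  rw [abs_div, abs_of_pos (by positivity : (0 : ℝ) < n + 2), div_le_iff₀ (by positivity)]
  refine (abs_sub _ _).trans ?_
  rw [abs_mul _ a, abs_mul _ b,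
    abs_of_pos (by positivity : (0 : ℝ) < 2 * ((n : ℝ) + 1 + lam)),
    abs_of_pos (by positivity : (0 : ℝ) < (n : ℝ) + 2 * lam)]
  calc _ ≤ 2 * ((n : ℝ) + 1 + lam) * p + ((n : ℝ) + 2 * lam) * q := by gcongr
    _ ≤ 2 * ((1 + lam) * (n + 2)) * p + ((1 + lam) * (n + 2)) * q := by
      gcongr <;> nlinarith
    _ = _ := by ring

theorem abs_gegenbauer_le {lam : ℝ} (hlam : 0 < lam) (n : ℕ) {x : ℝ} (hx : |x| ≤ 1) :
    |gegenbauer lam n x| ≤ (5 * (1 + lam)) ^ n := by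
  induction n using Nat.twoStepInduction with
  | zero => simp [gegenbauer_zero]
  | one =>
    rw [gegenbauer_one, abs_mul _ x, abs_of_pos (by positivity : 0 < 2 * lam), pow_one]
    nlinarith
  | more n h0 h1 =>
    have hxa : |x * gegenbauer lam (n + 1) x| ≤ (5 * (1 + lam)) ^ (n + 1) := by
      rw [abs_mul]
      exact (mul_le_of_le_one_left (abs_nonneg _) hx).trans h1
    rw [gegenbauer_add_two, mul_assoc]
    refine (abs_gegenbauer_step_le hlam n hxa h0).trans ?_
    have : 0 < (5 * (1 + lam)) ^ n := by positivity
    rw [pow_succ, pow_add]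
    nlinarith [mul_nonneg this.le (by nlinarith : 0 ≤ 15 * (1 + lam) ^ 2 - (1 + lam))]

theorem abs_gegenbauer_sub_gegenbauer_one_le {lam : ℝ} (hlam : 0 < lam) (n : ℕ) {x : ℝ}
    (hx : |x| ≤ 1) :
    |gegenbauer lam n x - gegenbauer lam n 1| ≤ (5 * (1 + lam)) ^ n * |x - 1| := by
  induction n using Nat.twoStepInduction with
  | zero => simp [gegenbauer_zero]
  | one =>
    rw [gegenbauer_one, gegenbauer_one, ← mul_sub, abs_mul _ (x - 1),
      abs_of_pos (by positivity : 0 < 2 * lam), pow_one]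
    exact mul_le_mul_of_nonneg_right (by linarith) (abs_nonneg _)
  | more n h0 h1 =>
    have hxa : |x * gegenbauer lam (n + 1) x - 1 * gegenbauer lam (n + 1) 1| ≤
        2 * ((5 * (1 + lam)) ^ (n + 1) * |x - 1|) := by
      have h := abs_gegenbauer_le hlam (n + 1) (x := 1) (by simp)
      calc _ = |x * (gegenbauer lam (n + 1) x - gegenbauer lam (n + 1) 1) +
            gegenbauer lam (n + 1) 1 * (x - 1)| := by congr 1; ring
        _ ≤ |x| * |gegenbauer lam (n + 1) x - gegenbauer lam (n + 1) 1| +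
            |gegenbauer lam (n + 1) 1| * |x - 1| := by
          rw [← abs_mul, ← abs_mul]; exact abs_add_le _ _
        _ ≤ 1 * ((5 * (1 + lam)) ^ (n + 1) * |x - 1|) +
            (5 * (1 + lam)) ^ (n + 1) * |x - 1| := by gcongr
        _ = _ := by ring
    have hstep := abs_gegenbauer_step_le hlam n hxa h0
    have hrec : gegenbauer lam (n + 2) x - gegenbauer lam (n + 2) 1 =
        (2 * ((n : ℝ) + 1 + lam) *
            (x * gegenbauer lam (n + 1) x - 1 * gegenbauer lam (n + 1) 1) -
          ((n : ℝ) + 2 * lam) * (gegenbauer lam n x - gegenbauer lam n 1)) / ((n : ℝ) + 2) := by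
      rw [gegenbauer_add_two, gegenbauer_add_two]
      ring
    rw [hrec]
    refine hstep.trans ?_
    have : 0 ≤ (5 * (1 + lam)) ^ n * |x - 1| := by positivity
    rw [pow_succ, pow_add]
    nlinarith [mul_nonneg this (by nlinarith : 0 ≤ 5 * (1 + lam) ^ 2 - (1 + lam))]

theorem gegenbauer_succ_one {lam : ℝ} (n : ℕ) :
    ((n : ℝ) + 1) * gegenbauer lam (n + 1) 1 = ((n : ℝ) + 2 * lam) * gegenbauer lam n 1 := by
  induction n with
  | zero => simp [gegenbauer_zero, gegenbauer_one]
  | succ n ih =>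
    have hn : (n : ℝ) + 2 ≠ 0 := by positivity
    rw [gegenbauer_add_two, ← ih]
    push_cast
    field_simp
    ring

theorem pow_le_gegenbauer_one {lam : ℝ} (hlam : 0 < lam) (n : ℕ) :
    (lam / (1 + lam)) ^ n ≤ gegenbauer lam n 1 := by
  induction n with
  | zero => simp [gegenbauer_zero]
  | succ n ih =>
    have hn : (0 : ℝ) ≤ n := n.cast_nonneg
    have h : gegenbauer lam (n + 1) 1 =
        gegenbauer lam n 1 * (((n : ℝ) + 2 * lam) / ((n : ℝ) + 1)) := by
      have := gegenbauer_succ_one (lam := lam) n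
      field_simp
      linarith
    rw [h, pow_succ]
    have hratio : lam / (1 + lam) ≤ ((n : ℝ) + 2 * lam) / ((n : ℝ) + 1) := by
      rw [div_le_div_iff₀ (by positivity) (by positivity)]
      nlinarith [mul_nonneg hn hlam.le]
    exact mul_le_mul ih hratio (by positivity) ((by positivity : 0 ≤ (lam / (1 + lam)) ^ n).trans ih)

theorem intervalIntegrable_one_sub_sq_rpow {lam : ℝ} (hlam : 0 < lam) :
    IntervalIntegrable (fun u : ℝ => (1 - u ^ 2) ^ (lam - 1 / 2)) volume (-1) 1 := by
  have hright : IntervalIntegrable (fun u : ℝ => (1 - u ^ 2) ^ (lam - 1 / 2)) volume 0 1 := by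
    have h1 : IntervalIntegrable (fun u : ℝ => (1 - u) ^ (lam - 1 / 2)) volume 0 1 := by
      have := (intervalIntegral.intervalIntegrable_rpow' (a := 1) (b := 0) (r := lam - 1 / 2)
        (by linarith)).comp_sub_left 1
      simpa using this
    have h2 : ContinuousOn (fun u : ℝ => (1 + u) ^ (lam - 1 / 2)) (uIcc 0 1) := by
      refine ContinuousOn.rpow_const (by fun_prop) fun u hu => Or.inl ?_
      rw [uIcc_of_le zero_le_one] at hu
      linarith [hu.1]
    refine (h1.mul_continuousOn h2).congr fun u hu => ?_
    rw [uIoc_of_le zero_le_one] at hu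
    rw [← mul_rpow (by linarith [hu.2]) (by linarith [hu.1])]
    congr 1
    ring
  have hleft : IntervalIntegrable (fun u : ℝ => (1 - u ^ 2) ^ (lam - 1 / 2)) volume (-1) 0 := by
    simpa using (hright.comp_sub_left 0).symm
  exact hleft.trans hright

theorem le_gegenbauerNormSq {lam : ℝ} (hlam : 0 < lam) (n : ℕ) :
    (1 / 4) ^ (1 + lam) / 4 * ((lam / (1 + lam) / (5 * (1 + lam))) ^ (1 + lam) *
      (lam / (1 + lam)) ^ 2) ^ n ≤ gegenbauerNormSq lam n := by
  set r := lam / (1 + lam) with hr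
  set A := 5 * (1 + lam) with hA
  have hr0 : 0 < r := by positivity
  have hr1 : r ≤ 1 := by rw [hr, div_le_one (by positivity)]; linarith
  have hA1 : 1 ≤ A := by linarith
  have hA0 : 0 < A := by linarith
  set d := 1 / 4 * (r / A) ^ n with hd
  have hd0 : 0 < d := by positivity
  have hd1 : d ≤ 1 / 4 := by
    have : (r / A) ^ n ≤ 1 := pow_le_one₀ (by positivity)
      ((div_le_one hA0).2 (hr1.trans hA1))
    linarith
  have hint : IntervalIntegrable
      (fun u : ℝ => (1 - u ^ 2) ^ (lam - 1 / 2) * gegenbauer lam n u ^ 2) volume (-1) 1 :=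
    (intervalIntegrable_one_sub_sq_rpow hlam).mul_continuousOn
      ((continuous_gegenbauer lam n).pow 2).continuousOn
  have hsub : ∫ u in (1 - 2 * d)..(1 - d), (1 - u ^ 2) ^ (lam - 1 / 2) * gegenbauer lam n u ^ 2
      ≤ gegenbauerNormSq lam n := by
    refine intervalIntegral.integral_mono_interval (by linarith) (by linarith) (by linarith) ?_ hint
    refine (ae_restrict_iff' measurableSet_Ioc).2 (Filter.Eventually.of_forall fun u hu => ?_)
    have : 0 ≤ 1 - u ^ 2 := by nlinarith [hu.1, hu.2]
    simp only [Pi.zero_apply]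
    positivity
  have hlow : ∫ _u in (1 - 2 * d)..(1 - d), d ^ lam * (r ^ n / 2) ^ 2 ≤
      ∫ u in (1 - 2 * d)..(1 - d), (1 - u ^ 2) ^ (lam - 1 / 2) * gegenbauer lam n u ^ 2 := by
    refine intervalIntegral.integral_mono_on (by linarith) (by simp) ?_ fun u hu => ?_
    · refine hint.mono_set ?_
      rw [uIcc_of_le (by linarith), uIcc_of_le (by linarith)]
      exact Icc_subset_Icc (by linarith) (by linarith)
    have hu0 : 0 ≤ u := by linarith [hu.1]
    have hu1 : u ≤ 1 := by linarith [hu.2]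
    have hud : d ≤ 1 - u ^ 2 := by nlinarith [hu.2]
    have hw : d ^ lam ≤ (1 - u ^ 2) ^ (lam - 1 / 2) :=
      (rpow_le_rpow hd0.le hud hlam.le).trans
        (rpow_le_rpow_of_exponent_ge (hd0.trans_le hud) (by nlinarith) (by linarith))
    have hlip := abs_gegenbauer_sub_gegenbauer_one_le hlam n (abs_le.2 ⟨by linarith, hu1⟩)
    have hdist : A ^ n * |u - 1| ≤ r ^ n / 2 := by
      calc _ ≤ A ^ n * (2 * d) := by
            gcongr
            rw [abs_le]
            constructor <;> linarith [hu.1]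
        _ = _ := by
            rw [hd, div_pow]
            field_simp
            norm_num
    have hone := pow_le_gegenbauer_one hlam n
    have hg : r ^ n / 2 ≤ gegenbauer lam n u := by
      linarith [neg_le_of_abs_le (hlip.trans hdist)]
    exact mul_le_mul hw (by gcongr) (by positivity) ((rpow_pos_of_pos hd0 _).le.trans hw)
  refine le_trans (le_of_eq ?_) (hlow.trans hsub)
  rw [intervalIntegral.integral_const, smul_eq_mul]
  have hpow : d ^ (1 + lam) = d * d ^ lam := by rw [rpow_add hd0, rpow_one]
  have hpow' : d ^ (1 + lam) = (1 / 4) ^ (1 + lam) * ((r / A) ^ (1 + lam)) ^ n := by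
    rw [hd, mul_rpow (by norm_num) (by positivity), ← rpow_natCast, ← rpow_natCast,
      ← rpow_mul (by positivity), ← rpow_mul (by positivity), mul_comm (n : ℝ)]
  calc _ = (1 / 4) ^ (1 + lam) * ((r / A) ^ (1 + lam)) ^ n * (r ^ n / 2) ^ 2 := by
        rw [mul_pow, ← pow_mul, mul_comm 2 n, pow_mul]; ring
    _ = _ := by rw [← hpow', hpow]; ring

theorem exists_abs_gegenbauer_mul_div_normSq_le {lam : ℝ} (hlam : 0 < lam) :
    ∃ K M : ℝ, 0 < K ∧ 0 < M ∧ ∀ (n : ℕ) (u v : ℝ), |u| ≤ 1 → |v| ≤ 1 →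
      |gegenbauer lam n u * gegenbauer lam n v / (2 * gegenbauerNormSq lam n)| ≤ K * M ^ n := by
  set c := (1 / 4 : ℝ) ^ (1 + lam) / 4
  set q := (lam / (1 + lam) / (5 * (1 + lam))) ^ (1 + lam) * (lam / (1 + lam)) ^ 2
  have hc : 0 < c := by positivity
  have hq : 0 < q := by positivity
  refine ⟨1 / (2 * c), (5 * (1 + lam)) ^ 2 / q, by positivity, by positivity,
    fun n u v hu hv => ?_⟩
  have hN : c * q ^ n ≤ gegenbauerNormSq lam n := le_gegenbauerNormSq hlam n
  have hN0 : 0 < gegenbauerNormSq lam n := (by positivity : 0 < c * q ^ n).trans_le hN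
  rw [abs_div, abs_mul, abs_of_pos (by positivity : 0 < 2 * gegenbauerNormSq lam n)]
  calc _ ≤ (5 * (1 + lam)) ^ n * (5 * (1 + lam)) ^ n / (2 * (c * q ^ n)) := by
        gcongr
        exacts [abs_gegenbauer_le hlam n hu, abs_gegenbauer_le hlam n hv]
    _ = _ := by
        rw [div_pow, ← pow_mul, mul_comm 2 n, pow_mul]
        field_simp

/-- A series dominated by a geometric series of small ratio is close to its first term. -/
theorem abs_tsum_sub_zero_le_of_geometric {f : ℕ → ℝ} {K z : ℝ} (hK : 0 ≤ K) (hz0 : 0 ≤ z)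
    (hz : z ≤ 1 / 2) (hf : ∀ n, |f n| ≤ K * z ^ n) : |∑' n, f n - f 0| ≤ 2 * K * z := by
  have hgeo := hasSum_geometric_of_lt_one hz0 (by linarith)
  have hsum : Summable f := (hgeo.summable.mul_left K).of_norm_bounded hf
  have hbound : ∀ n, ‖f (n + 1)‖ ≤ K * z * z ^ n := fun n => by
    simpa [pow_succ, mul_assoc, mul_comm, mul_left_comm] using hf (n + 1)
  rw [hsum.tsum_eq_zero_add, add_sub_cancel_left]
  refine (tsum_of_norm_bounded (hgeo.mul_left (K * z)) hbound).trans ?_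
  have : (1 - z)⁻¹ ≤ 2 := by
    rw [inv_le_comm₀ (by linarith) (by norm_num)]
    linarith
  nlinarith [mul_nonneg hK hz0]

theorem radialDensity_comparable (κ : ℝ) (hκ : 0 < κ) :
    ∃ t0 : ℝ, 1 ≤ t0 ∧ ∃ C1 C2 : ℝ, 0 < C1 ∧ C1 ≤ C2 ∧
      ∀ t, t0 ≤ t → ∀ x ∈ Set.Ioo (0:ℝ) (2*Real.pi), ∀ y ∈ Set.Ioo (0:ℝ) (2*Real.pi),
        C1 * Real.sin (y/2) ^ (8/κ) ≤ radialDensity κ t x y ∧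
        radialDensity κ t x y ≤ C2 * Real.sin (y/2) ^ (8/κ) := by
  have hlam : 0 < 4 / κ := by positivity
  obtain ⟨K, M, hK, hM, hbound⟩ := exists_abs_gegenbauer_mul_div_normSq_le hlam
  set a := 1 / (2 * gegenbauerNormSq (4 / κ) 0) with ha
  have ha0 : 0 < a := by
    have : 0 < gegenbauerNormSq (4 / κ) 0 := lt_of_lt_of_le (by positivity)
      (le_gegenbauerNormSq hlam 0)
    positivity
  have hlim : Filter.Tendsto (fun t : ℝ => M * exp (-t)) Filter.atTop (nhds 0) := by
    simpa using (tendsto_exp_neg_atTop_nhds_zero.const_mul M)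
  obtain ⟨T, hT⟩ := Filter.eventually_atTop.1
    (hlim.eventually_le_const (by positivity : 0 < min (1 / 2) (a / (4 * K))))
  refine ⟨max 1 T, le_max_left _ _, a / 2, 3 * a / 2, by positivity, by linarith,
    fun t ht x _ y hy => ?_⟩
  have ht0 : 0 ≤ t := zero_le_one.trans ((le_max_left _ _).trans ht)
  have hz := hT t ((le_max_right _ _).trans ht)
  have hz2 : M * exp (-t) ≤ a / (4 * K) := hz.trans (min_le_right _ _)
  set f : ℕ → ℝ := fun n => gegenbauer (4 / κ) n (cos (x / 2)) *
    gegenbauer (4 / κ) n (cos (y / 2)) / (2 * gegenbauerNormSq (4 / κ) n) *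
      exp (-(n : ℝ) * (1 + κ / 8 * (n : ℝ)) * t) with hf
  have hdens : radialDensity κ t x y = sin (y / 2) ^ (8 / κ) * ∑' n, f n := by
    rw [radialDensity, ← tsum_mul_left]
    exact tsum_congr fun n => by ring
  have hf0 : f 0 = a := by simp [hf, gegenbauer_zero, ha]
  have hfn : ∀ n, |f n| ≤ K * (M * exp (-t)) ^ n := fun n => by
    rw [abs_mul, abs_of_pos (exp_pos _), mul_pow, ← exp_nat_mul, ← mul_assoc]
    have hexp : -(n : ℝ) * (1 + κ / 8 * (n : ℝ)) * t ≤ n * -t := by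
      have : 0 ≤ κ / 8 * (n : ℝ) * n * t := by positivity
      linarith
    exact mul_le_mul (hbound n _ _ (abs_cos_le_one _) (abs_cos_le_one _)) (exp_le_exp.2 hexp)
      (exp_pos _).le (by positivity)
  have htail := abs_tsum_sub_zero_le_of_geometric hK.le (by positivity)
    (hz.trans (min_le_left _ _)) hfn
  have hsmall : 2 * K * (M * exp (-t)) ≤ a / 2 := by
    rw [le_div_iff₀ (by positivity)] at hz2
    linarith
  rw [hf0] at htail
  obtain ⟨hlo, hhi⟩ := abs_le.1 (htail.trans hsmall)
  have hsin : 0 ≤ sin (y / 2) ^ (8 / κ) := rpow_nonneg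
    (sin_nonneg_of_nonneg_of_le_pi (by linarith [hy.1]) (by linarith [hy.2])) _
  rw [hdens, mul_comm _ (∑' n, f n)]
  constructor <;> gcongr <;> linarith
end

section
/- Let $f$ be a univalent analytic function on the unit disc $\mathbb{D}$ with $f(0)=0$ and $|f'(0)| = a > 0$. Then for all $z \in \mathbb{D}$: $\frac{a|z|}{(1+|z|)^2} \le |f(z)| \le \frac{a|z|}{(1-|z|)^2}$. -/
open Metric

open MeasureTheory Set Filter Topology in
lemma lintegral_image_inv_norm_sq {R : Set ℂ} (hR : MeasurableSet R) {F F' : ℂ → ℂ}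
    (hF : ∀ ζ ∈ R, HasDerivAt F (F' ζ) ζ) (hinj : InjOn F R) :
    ∫⁻ w in F '' R, ENNReal.ofReal ((‖w‖ ^ 2)⁻¹) =
      ∫⁻ ζ in R, ENNReal.ofReal (‖F' ζ / F ζ‖ ^ 2) := by
  rw [lintegral_image_eq_lintegral_abs_det_fderiv_mul volume hR
    (fun ζ hζ => ((hF ζ hζ).hasFDerivAt.restrictScalars ℝ).hasFDerivWithinAt) hinj]
  refine setLIntegral_congr_fun hR fun ζ _ => ?_
  have : ((ContinuousLinearMap.toSpanSingleton ℂ (F' ζ)).restrictScalars ℝ).det = ‖F' ζ‖ ^ 2 := by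
    rw [ContinuousLinearMap.det]
    simp [LinearMap.det_restrictScalars, Algebra.norm_complex_apply, Complex.normSq_eq_norm_sq]
  simp only [this]
  rw [← ENNReal.ofReal_mul (abs_nonneg _), abs_of_nonneg (by positivity), norm_div, div_pow,
    div_eq_mul_inv]

open MeasureTheory Set Filter Topology Real in
lemma ofReal_le_lintegral_norm_sq_circle {H : ℂ → ℂ} (hH : DifferentiableOn ℂ H (ball 0 1))
    {x : ℝ} (hx : x < 0) :
    ENNReal.ofReal (2 * π * ‖H 0‖ ^ 2) ≤
      ∫⁻ θ in Ioc (-π) π, ENNReal.ofReal (‖H (Complex.exp (x + θ * Complex.I))‖ ^ 2) := by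
  have hr : 0 < rexp x := exp_pos x
  have hr1 : rexp x < 1 := by simpa using hx
  have hexp : ∀ θ : ℝ, Complex.exp (x + θ * Complex.I) = circleMap 0 (rexp x) θ := by
    intro θ; simp [circleMap, Complex.exp_add]
  simp_rw [hexp]
  have hmem : ∀ θ, circleMap 0 (rexp x) θ ∈ ball (0 : ℂ) 1 := by
    intro θ; simp [circleMap, hx]
  have hcont : Continuous fun θ => H (circleMap 0 (rexp x) θ) :=
    hH.continuousOn.comp_continuous (continuous_circleMap 0 _) hmem
  have hmean : Real.circleAverage (fun z => H z ^ 2) 0 (rexp x) = H 0 ^ 2 := by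
    refine DiffContOnCl.circleAverage (DifferentiableOn.diffContOnCl ?_)
    refine (hH.pow 2).mono ?_
    rw [abs_of_pos hr]
    exact closure_ball_subset_closedBall.trans (closedBall_subset_ball hr1)
  have hper : Function.Periodic (fun θ => H (circleMap 0 (rexp x) θ) ^ 2) (2 * π) := fun θ => by
    simp only [periodic_circleMap 0 (rexp x) θ]
  have hint : ∫ θ in (-π)..π, H (circleMap 0 (rexp x) θ) ^ 2 = (2 * π : ℝ) • H 0 ^ 2 := by
    rw [← hmean, Real.circleAverage_def, smul_inv_smul₀ (by positivity)]
    have := hper.intervalIntegral_add_eq (-π) 0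
    rw [show -π + 2 * π = π by ring, zero_add] at this
    exact this
  rw [← ofReal_integral_eq_lintegral_ofReal]
  · apply ENNReal.ofReal_le_ofReal
    rw [← intervalIntegral.integral_of_le (by linarith [pi_pos])]
    calc 2 * π * ‖H 0‖ ^ 2 = ‖∫ θ in (-π)..π, H (circleMap 0 (rexp x) θ) ^ 2‖ := by
          rw [hint, norm_smul, norm_pow, Real.norm_of_nonneg (by positivity)]
      _ ≤ ∫ θ in (-π)..π, ‖H (circleMap 0 (rexp x) θ) ^ 2‖ :=
          intervalIntegral.norm_integral_le_integral_norm (by linarith [pi_pos])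
      _ = _ := by simp only [norm_pow]
  · exact ((hcont.norm.pow 2).integrableOn_Icc (a := -π) (b := π)).mono_set Ioc_subset_Icc_self
  · exact Eventually.of_forall fun θ => by positivity

open MeasureTheory Set Filter Topology Real in
lemma ofReal_le_lintegral_norm_sq_exp {H : ℂ → ℂ} (hH : DifferentiableOn ℂ H (ball 0 1))
    (L : ℝ) :
    ENNReal.ofReal (L * (2 * π * ‖H 0‖ ^ 2)) ≤
      ∫⁻ ζ in Ioo (-L) 0 ×ℂ Ioc (-π) π, ENNReal.ofReal (‖H (Complex.exp ζ)‖ ^ 2) := by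
  have hS : MeasurableSet (Ioo (-L) 0 ×ℂ Ioc (-π) π) :=
    (measurableSet_Ioo.preimage Complex.measurable_re).inter
      (measurableSet_Ioc.preimage Complex.measurable_im)
  have hmp := Complex.volume_preserving_equiv_real_prod.symm
  rw [← hmp.setLIntegral_comp_preimage_emb Complex.measurableEquivRealProd.symm.measurableEmbedding]
  have hpre : Complex.measurableEquivRealProd.symm ⁻¹' (Ioo (-L) 0 ×ℂ Ioc (-π) π) =
      Ioo (-L) 0 ×ˢ Ioc (-π) π := by
    ext p; simp [Complex.mem_reProdIm, Complex.measurableEquivRealProd_symm_apply]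
  have happ : ∀ p : ℝ × ℝ, Complex.measurableEquivRealProd.symm p = p.1 + p.2 * Complex.I := by
    intro p
    rw [Complex.measurableEquivRealProd_symm_apply]
    apply Complex.ext <;> simp
  rw [hpre]
  simp only [happ]
  rw [Measure.volume_eq_prod, ← Measure.prod_restrict, lintegral_prod]
  · calc ENNReal.ofReal (L * (2 * π * ‖H 0‖ ^ 2))
        = ∫⁻ _ in Ioo (-L) 0, ENNReal.ofReal (2 * π * ‖H 0‖ ^ 2) := by
          rw [setLIntegral_const, Real.volume_Ioo, mul_comm L, ENNReal.ofReal_mul (by positivity)]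
          simp
      _ ≤ _ := setLIntegral_mono' measurableSet_Ioo fun x hx =>
          ofReal_le_lintegral_norm_sq_circle hH hx.2
  · rw [Measure.prod_restrict]
    apply AEMeasurable.ennreal_ofReal
    refine ContinuousOn.aemeasurable ?_ (measurableSet_Ioo.prod measurableSet_Ioc)
    refine (hH.continuousOn.comp (by fun_prop) ?_).norm.pow 2
    intro p hp
    simpa [Complex.norm_exp] using hp.1.2

open MeasureTheory Set Filter Topology Real in
lemma lintegral_annulus_inv_norm_sq_le {m : ℝ} (hm : 0 < m) :
    ∫⁻ w in {w : ℂ | m ≤ ‖w‖ ∧ ‖w‖ ≤ m⁻¹}, ENNReal.ofReal ((‖w‖ ^ 2)⁻¹) ≤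
      ENNReal.ofReal (4 * π * log m⁻¹) := by
  set R : Set ℂ := Icc (log m) (log m⁻¹) ×ℂ Ioc (-π) π with hRdef
  have hR : MeasurableSet R := 
    (measurableSet_Icc.preimage Complex.measurable_re).inter
      (measurableSet_Ioc.preimage Complex.measurable_im)
  have hsub : {w : ℂ | m ≤ ‖w‖ ∧ ‖w‖ ≤ m⁻¹} ⊆ Complex.exp '' R := by
    rintro w ⟨h1, h2⟩
    have hw : 0 < ‖w‖ := hm.trans_le h1
    refine ⟨Complex.log w, ?_, Complex.exp_log (norm_pos_iff.1 hw)⟩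
    rw [hRdef, Complex.mem_reProdIm, Complex.log_re]
    exact ⟨⟨log_le_log hm h1, log_le_log hw h2⟩, Complex.neg_pi_lt_log_im w, Complex.log_im_le_pi w⟩
  have hinj : InjOn Complex.exp R := by
    intro x hx y hy h
    rw [hRdef, Complex.mem_reProdIm] at hx hy
    rw [← Complex.log_exp hx.2.1 hx.2.2, h, Complex.log_exp hy.2.1 hy.2.2]
  have hvol : volume R = ENNReal.ofReal (log m⁻¹ - log m) * ENNReal.ofReal (2 * π) := by
    rw [← (Complex.volume_preserving_equiv_real_prod.symm).measure_preimage hR.nullMeasurableSet]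
    have hpre : Complex.measurableEquivRealProd.symm ⁻¹' R =
        Icc (log m) (log m⁻¹) ×ˢ Ioc (-π) π := by
      ext p; simp [hRdef, Complex.mem_reProdIm, Complex.measurableEquivRealProd_symm_apply]
    rw [hpre, Measure.volume_eq_prod, Measure.prod_prod, Real.volume_Icc, Real.volume_Ioc]
    ring_nf
  calc _ ≤ ∫⁻ w in Complex.exp '' R, ENNReal.ofReal ((‖w‖ ^ 2)⁻¹) := lintegral_mono_set hsub
    _ = _ := by
      rw [lintegral_image_inv_norm_sq hR (fun ζ _ => Complex.hasDerivAt_exp ζ) hinj]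
      simp only [div_self (Complex.exp_ne_zero _), norm_one, one_pow, ENNReal.ofReal_one,
        setLIntegral_one, hvol]
      rw [← ENNReal.ofReal_mul' (by positivity), log_inv]
      ring_nf

open Filter Topology Set in
lemma HasStrictDerivAt.closedBall_subset_image_closedBall {φ : ℂ → ℂ} {c b : ℂ}
    (h : HasStrictDerivAt φ c b) {κ : ℝ} (hκ : κ < ‖c‖) :
    ∃ δ > 0, ∀ ρ ∈ Ioc 0 δ, closedBall (φ b) (κ * ρ) ⊆ φ '' closedBall b ρ := by
  rcases lt_or_ge κ 0 with hκ0 | hκ0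
  · refine ⟨1, one_pos, fun ρ hρ => ?_⟩
    rw [closedBall_eq_empty.2 (mul_neg_of_neg_of_pos hκ0 hρ.1)]
    exact empty_subset _
  have hc : c ≠ 0 := norm_pos_iff.1 (hκ0.trans_lt hκ)
  obtain ⟨s, hs, happ⟩ := h.hasStrictFDerivAt.approximates_deriv_on_nhds
    (c := (‖c‖ - κ).toNNReal) (Or.inr (by simpa using hκ))
  obtain ⟨δ, hδ, hδs⟩ := nhds_basis_closedBall.mem_iff.1 hs
  let inv : (ContinuousLinearMap.toSpanSingleton ℂ c).NonlinearRightInverse :=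
    { toFun := fun y => y / c
      nnnorm := ‖c‖₊⁻¹
      bound' := fun y => by simp [div_eq_inv_mul]
      right_inv' := fun y => by simp [hc] }
  refine ⟨δ, hδ, fun ρ hρ => ?_⟩
  have := happ.surjOn_closedBall_of_nonlinearRightInverse inv hρ.1.le
    ((closedBall_subset_closedBall hρ.2).trans hδs)
  simpa [inv, SurjOn, hκ.le] using this

open MeasureTheory Set Filter Topology Real in
/-- A univalent Bieberbach-Eilenberg function has derivative at most one at the origin. -/
theorem norm_deriv_le_one_of_mul_ne_one {φ : ℂ → ℂ} (hφ : DifferentiableOn ℂ φ (ball 0 1))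
    (hinj : InjOn φ (ball 0 1)) (h0 : φ 0 = 0)
    (hne : ∀ x ∈ ball (0 : ℂ) 1, ∀ y ∈ ball (0 : ℂ) 1, φ x * φ y ≠ 1) :
    ‖deriv φ 0‖ ≤ 1 := by
  by_contra! hc
  have h0mem : (0 : ℂ) ∈ ball (0 : ℂ) 1 := by simp
  have hnhds : ball (0 : ℂ) 1 ∈ 𝓝 (0 : ℂ) := isOpen_ball.mem_nhds h0mem
  have hφz : ∀ z ∈ ball (0 : ℂ) 1, z ≠ 0 → φ z ≠ 0 := fun z hz hz0 h =>
    hz0 (hinj hz h0mem (h.trans h0.symm))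
  obtain ⟨H, hH, hH0, hHz⟩ : ∃ H : ℂ → ℂ, DifferentiableOn ℂ H (ball 0 1) ∧ H 0 = 1 ∧
      ∀ z ∈ ball (0 : ℂ) 1, z ≠ 0 → H z = z * deriv φ z / φ z := by
    have hq : DifferentiableOn ℂ (dslope φ 0) (ball 0 1) :=
      (Complex.differentiableOn_dslope hnhds).2 hφ
    have hmul : ∀ z, φ z = z * dslope φ 0 z := fun z => by
      simpa [h0] using (sub_smul_dslope φ 0 z).symm
    have hq0 : ∀ z ∈ ball (0 : ℂ) 1, dslope φ 0 z ≠ 0 := by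
      intro z hz h
      rcases eq_or_ne z 0 with rfl | hz0
      · rw [dslope_same] at h
        rw [h, norm_zero] at hc
        linarith
      · exact hφz z hz hz0 (by rw [hmul, h, mul_zero])
    refine ⟨fun z => 1 + z * deriv (dslope φ 0) z / dslope φ 0 z, ?_, by simp, ?_⟩
    · exact ((differentiableOn_id.mul (hq.deriv isOpen_ball)).div hq hq0).const_add 1
    · intro z hz hz0
      have hd := (hq.differentiableAt (isOpen_ball.mem_nhds hz)).hasDerivAt
      have hd' : HasDerivAt φ (1 * dslope φ 0 z + z * deriv (dslope φ 0) z) z :=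
        ((hasDerivAt_id z).mul hd).congr_of_eventuallyEq (Eventually.of_forall hmul)
      rw [hd'.deriv, hmul z]
      have := hq0 z hz
      field_simp
  obtain ⟨κ, hκ1, hκc⟩ := exists_between hc
  have hstrict : HasStrictDerivAt φ (deriv φ 0) 0 :=
    (hφ.analyticAt hnhds).hasStrictDerivAt
  obtain ⟨δ, hδ, hcov⟩ := hstrict.closedBall_subset_image_closedBall hκc
  obtain ⟨ρ, hρ0, hρ⟩ := exists_between (lt_min hδ one_pos)
  have hρ1 : ρ < 1 := hρ.trans_le (min_le_right _ _)
  have hcov' : closedBall 0 (κ * ρ) ⊆ φ '' closedBall 0 ρ := by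
    simpa [h0] using hcov ρ ⟨hρ0, hρ.le.trans (min_le_left _ _)⟩
  have hsubball : closedBall (0 : ℂ) ρ ⊆ ball 0 1 := closedBall_subset_ball hρ1
  set m := κ * ρ with hm
  have hm0 : 0 < m := by positivity
  set R : Set ℂ := Ioo (log ρ) 0 ×ℂ Ioc (-π) π with hRdef
  have hR : MeasurableSet R := (measurableSet_Ioo.preimage Complex.measurable_re).inter
      (measurableSet_Ioc.preimage Complex.measurable_im)
  have hexpR : ∀ ζ ∈ R, ρ < ‖Complex.exp ζ‖ ∧ Complex.exp ζ ∈ ball (0 : ℂ) 1 := by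
    intro ζ hζ
    rw [hRdef, Complex.mem_reProdIm] at hζ
    rw [mem_ball_zero_iff, Complex.norm_exp]
    exact ⟨(log_lt_iff_lt_exp hρ0).1 hζ.1.1, by simpa using hζ.1.2⟩
  have hexpinj : InjOn Complex.exp R := by
    intro x hx y hy h
    rw [hRdef, Complex.mem_reProdIm] at hx hy
    rw [← Complex.log_exp hx.2.1 hx.2.2, h, Complex.log_exp hy.2.1 hy.2.2]
  set F : ℂ → ℂ := fun ζ => φ (Complex.exp ζ)
  have hFne : ∀ ζ ∈ R, F ζ ≠ 0 := fun ζ hζ => hφz _ (hexpR ζ hζ).2 (Complex.exp_ne_zero ζ)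
  have hF : ∀ ζ ∈ R, HasDerivAt F (deriv φ (Complex.exp ζ) * Complex.exp ζ) ζ := fun ζ hζ =>
    (hφ.differentiableAt (isOpen_ball.mem_nhds (hexpR ζ hζ).2)).hasDerivAt.comp ζ
      (Complex.hasDerivAt_exp ζ)
  have hFinj : InjOn F R := fun x hx y hy h =>
    hexpinj hx hy (hinj (hexpR x hx).2 (hexpR y hy).2 h)
  have hGinj : InjOn (fun ζ => (F ζ)⁻¹) R := fun x hx y hy h => hFinj hx hy (inv_injective h)
  have hG : ∀ ζ ∈ R, HasDerivAt (fun ζ => (F ζ)⁻¹)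
      (-(deriv φ (Complex.exp ζ) * Complex.exp ζ) / F ζ ^ 2) ζ := fun ζ hζ =>
    (hF ζ hζ).fun_inv (hFne ζ hζ)
  have hlow : ENNReal.ofReal (-log ρ * (2 * π)) ≤
      ∫⁻ ζ in R, ENNReal.ofReal (‖H (Complex.exp ζ)‖ ^ 2) := by
    have := ofReal_le_lintegral_norm_sq_exp hH (-log ρ)
    rwa [hH0, norm_one, one_pow, mul_one, neg_neg] at this
  have hA1 : ∫⁻ w in F '' R, ENNReal.ofReal ((‖w‖ ^ 2)⁻¹) =
      ∫⁻ ζ in R, ENNReal.ofReal (‖H (Complex.exp ζ)‖ ^ 2) := by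
    rw [lintegral_image_inv_norm_sq hR hF hFinj]
    refine setLIntegral_congr_fun hR fun ζ hζ => ?_
    simp only [hHz _ (hexpR ζ hζ).2 (Complex.exp_ne_zero ζ), F, mul_comm]
  have hA2 : ∫⁻ w in (fun ζ => (F ζ)⁻¹) '' R, ENNReal.ofReal ((‖w‖ ^ 2)⁻¹) =
      ∫⁻ ζ in R, ENNReal.ofReal (‖H (Complex.exp ζ)‖ ^ 2) := by
    rw [lintegral_image_inv_norm_sq hR hG hGinj]
    refine setLIntegral_congr_fun hR fun ζ hζ => ?_
    have h1 := hFne ζ hζ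
    have h2 : -(deriv φ (Complex.exp ζ) * Complex.exp ζ) / F ζ ^ 2 / (F ζ)⁻¹ =
        -H (Complex.exp ζ) := by
      rw [hHz _ (hexpR ζ hζ).2 (Complex.exp_ne_zero ζ)]
      change _ = -(_ / F ζ)
      field_simp
    simp only [h2, norm_neg]
  have hdisj : Disjoint (F '' R) ((fun ζ => (F ζ)⁻¹) '' R) := by
    rw [Set.disjoint_left]
    rintro _ ⟨x, hx, rfl⟩ ⟨y, hy, h⟩
    refine hne _ (hexpR x hx).2 _ (hexpR y hy).2 ?_
    change F x * F y = 1
    rw [← h]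
    exact inv_mul_cancel₀ (hFne y hy)
  have hmeas : MeasurableSet ((fun ζ => (F ζ)⁻¹) '' R) :=
    hR.image_of_continuousOn_injOn (fun ζ hζ => (hG ζ hζ).continuousAt.continuousWithinAt) hGinj
  have hFm : ∀ ζ ∈ R, m ≤ ‖F ζ‖ := by
    intro ζ hζ
    by_contra! h
    obtain ⟨z, hz, hzφ⟩ := hcov' (mem_closedBall_zero_iff.2 h.le)
    have := hinj (hsubball hz) (hexpR ζ hζ).2 hzφ
    rw [this, mem_closedBall_zero_iff] at hz
    exact hz.not_gt (hexpR ζ hζ).1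
  have hGm : ∀ ζ ∈ R, m ≤ ‖(F ζ)⁻¹‖ := by
    intro ζ hζ
    by_contra! h
    obtain ⟨z, hz, hzφ⟩ := hcov' (mem_closedBall_zero_iff.2 h.le)
    refine hne _ (hsubball hz) _ (hexpR ζ hζ).2 ?_
    rw [hzφ]
    exact inv_mul_cancel₀ (hFne ζ hζ)
  have hsub : F '' R ∪ (fun ζ => (F ζ)⁻¹) '' R ⊆ {w : ℂ | m ≤ ‖w‖ ∧ ‖w‖ ≤ m⁻¹} := by
    rintro _ (⟨ζ, hζ, rfl⟩ | ⟨ζ, hζ, rfl⟩)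
    · refine ⟨hFm ζ hζ, ?_⟩
      have := hGm ζ hζ
      rw [norm_inv] at this
      exact (le_inv_comm₀ hm0 (norm_pos_iff.2 (hFne ζ hζ))).1 this
    · refine ⟨hGm ζ hζ, ?_⟩
      rw [norm_inv]
      exact inv_anti₀ hm0 (hFm ζ hζ)
  have hmain : ENNReal.ofReal (-log ρ * (2 * π) + -log ρ * (2 * π)) ≤
      ENNReal.ofReal (4 * π * log m⁻¹) := by
    refine le_trans ?_ ((lintegral_mono_set hsub).trans (lintegral_annulus_inv_norm_sq_le hm0))
    rw [lintegral_union hmeas hdisj, hA1, hA2]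
    exact ENNReal.ofReal_add_le.trans (add_le_add hlow hlow)
  have hlogρ := log_neg hρ0 hρ1
  have hpos : 0 < -log ρ * (2 * π) + -log ρ * (2 * π) := by
    have : 0 < -log ρ := by linarith
    positivity
  rcases ENNReal.ofReal_le_ofReal_iff'.1 hmain with h | h
  · have hlogm : log m = log κ + log ρ := log_mul (by positivity) (by positivity)
    rw [log_inv, hlogm] at h
    have hlogκ := log_pos hκ1
    nlinarith [pi_pos, mul_pos pi_pos hlogκ]
  · exact h.not_gt hpos

open Set in
lemma DifferentiableOn.exists_eq_mul_exp_of_ne_zero {k : ℂ → ℂ} {c : ℂ} {r : ℝ} (hr : 0 < r)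
    (hk : DifferentiableOn ℂ k (ball c r)) (hne : ∀ z ∈ ball c r, k z ≠ 0) :
    ∃ L : ℂ → ℂ, L c = 0 ∧ (∀ z ∈ ball c r, HasDerivAt L (_root_.deriv k z / k z) z) ∧
      ∀ z ∈ ball c r, k z = k c * Complex.exp (L z) := by
  obtain ⟨L, hL0, hL⟩ := ((hk.deriv isOpen_ball).div hk hne).isExactOn_ball.with_val_at c 0
  refine ⟨L, hL0, hL, fun z hz => ?_⟩
  have hder : ∀ z ∈ ball c r, HasDerivAt (fun z => k z * Complex.exp (-L z)) 0 z := by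
    intro z hz
    refine ((hk.differentiableAt (isOpen_ball.mem_nhds hz)).hasDerivAt.mul
      (hL z hz).fun_neg.cexp).congr_deriv ?_
    have := hne z hz
    simp only [Pi.div_apply]
    field_simp
    ring
  have hconst := isOpen_ball.is_const_of_deriv_eq_zero (convex_ball c r).isPreconnected
    (fun z hz => (hder z hz).differentiableAt.differentiableWithinAt)
    (fun z hz => (hder z hz).deriv) hz (mem_ball_self hr)
  simp only [hL0, neg_zero, Complex.exp_zero, mul_one] at hconst
  rw [← hconst, mul_assoc, ← Complex.exp_add, neg_add_cancel, Complex.exp_zero, mul_one]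

open Set in
/-- The **Koebe quarter theorem**, for an omitted value. -/
theorem norm_deriv_le_four_mul_norm_of_ne {g : ℂ → ℂ} (hg : DifferentiableOn ℂ g (ball 0 1))
    (hinj : InjOn g (ball 0 1)) (h0 : g 0 = 0) {w : ℂ} (hw : ∀ z ∈ ball (0 : ℂ) 1, g z ≠ w) :
    ‖deriv g 0‖ ≤ 4 * ‖w‖ := by
  have h0mem : (0 : ℂ) ∈ ball (0 : ℂ) 1 := by simp
  have hw0 : w ≠ 0 := fun h => hw 0 h0mem (h0.trans h.symm)
  have hkne : ∀ z ∈ ball (0 : ℂ) 1, 1 - g z / w ≠ 0 := by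
    intro z hz h
    rw [sub_eq_zero, eq_div_iff hw0, one_mul] at h
    exact hw z hz h.symm
  obtain ⟨L, hL0, hL, hexp⟩ := DifferentiableOn.exists_eq_mul_exp_of_ne_zero one_pos
    (k := fun z => 1 - g z / w) ((hg.div_const w).const_sub 1) hkne
  set h : ℂ → ℂ := fun z => Complex.exp (L z / 2) with hh
  have hsq : ∀ z ∈ ball (0 : ℂ) 1, h z ^ 2 = 1 - g z / w := by
    intro z hz
    rw [hexp z hz, hh, ← Complex.exp_nat_mul]
    simp [h0, mul_div_cancel₀]
  have hhz : ∀ z, h z ≠ 0 := fun z => Complex.exp_ne_zero _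
  have hinjh : ∀ x ∈ ball (0 : ℂ) 1, ∀ y ∈ ball (0 : ℂ) 1, h x ^ 2 = h y ^ 2 → x = y := by
    intro x hx y hy hxy
    rw [hsq x hx, hsq y hy, sub_right_inj, div_left_inj' hw0] at hxy
    exact hinj hx hy hxy
  have hneg : ∀ x ∈ ball (0 : ℂ) 1, ∀ y ∈ ball (0 : ℂ) 1, h x + h y ≠ 0 := by
    intro x hx y hy hxy
    obtain rfl := hinjh x hx y hy (by rw [eq_neg_of_add_eq_zero_left hxy, neg_sq])
    exact hhz x (by linear_combination hxy / 2)
  have hone : h 0 = 1 := by simp [hh, hL0]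
  have hplus : ∀ z ∈ ball (0 : ℂ) 1, h z + 1 ≠ 0 := fun z hz => by
    simpa [hone] using hneg z hz 0 h0mem
  have hhd : ∀ z ∈ ball (0 : ℂ) 1, DifferentiableAt ℂ h z := fun z hz =>
    ((hL z hz).differentiableAt.div_const 2).cexp
  have hφd : ∀ z ∈ ball (0 : ℂ) 1, DifferentiableAt ℂ (fun z => (h z - 1) / (h z + 1)) z :=
    fun z hz => ((hhd z hz).sub_const 1).fun_div ((hhd z hz).add_const 1) (hplus z hz)
  have key := norm_deriv_le_one_of_mul_ne_one (φ := fun z => (h z - 1) / (h z + 1))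
    (fun z hz => (hφd z hz).differentiableWithinAt)
    (fun x hx y hy hxy => hinjh x hx y hy (by
      have h1 := hplus x hx
      have h2 := hplus y hy
      simp only [div_eq_div_iff h1 h2] at hxy
      rw [show h x = h y by linear_combination hxy / 2]))
    (by simp [hone])
    (fun x hx y hy hxy => hneg x hx y hy (by
      have h1 := hplus x hx
      have h2 := hplus y hy
      rw [div_mul_div_comm, div_eq_one_iff_eq (mul_ne_zero h1 h2)] at hxy
      linear_combination -hxy / 2))
  have hgd : HasDerivAt g (deriv g 0) 0 :=
    (hg.differentiableAt (isOpen_ball.mem_nhds h0mem)).hasDerivAt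
  have hhd0 : HasDerivAt h (-deriv g 0 / (2 * w)) 0 := by
    refine ((hL 0 h0mem).div_const 2).cexp.congr_deriv ?_
    rw [((hgd.div_const w).const_sub 1).deriv, hL0, h0]
    simp
    field_simp
  have hder : HasDerivAt (fun z => (h z - 1) / (h z + 1)) (-deriv g 0 / (4 * w)) 0 := by
    refine ((hhd0.sub_const 1).fun_div (hhd0.add_const 1) (hplus 0 h0mem)).congr_deriv ?_
    rw [hone]
    field_simp
    ring
  rw [hder.deriv, norm_div, norm_neg, norm_mul, div_le_one (by simpa using hw0)] at key
  simpa using key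

open Set in
/-- The conformal map of the unit disc onto the disc slit along `[r, 1)`. -/
lemma exists_univalent_disc_to_slit_disc {r : ℝ} (hr0 : 0 < r) (hr1 : r < 1) :
    ∃ φ : ℂ → ℂ, DifferentiableOn ℂ φ (ball 0 1) ∧ InjOn φ (ball 0 1) ∧
      MapsTo φ (ball 0 1) (ball 0 1) ∧ φ 0 = 0 ∧ deriv φ 0 = ((4 * r / (1 + r) ^ 2 : ℝ) : ℂ) ∧
      ∀ z ∈ ball (0 : ℂ) 1, φ z ≠ r := by
  set c : ℝ := 4 * r / (1 + r) ^ 2 with hc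
  have hc0 : 0 < c := by positivity
  have hc1 : c < 1 := by
    rw [hc, div_lt_one (by positivity)]
    nlinarith [sq_pos_of_pos (sub_pos.2 hr1)]
  have hc0' : (c : ℂ) ≠ 0 := by exact_mod_cast hc0.ne'
  set s : ℂ → ℂ := fun z => (1 - z) / (1 + z) with hs
  have hden : ∀ z ∈ ball (0 : ℂ) 1, 1 + z ≠ 0 := by
    intro z hz h
    rw [eq_neg_of_add_eq_zero_right h] at hz
    simp at hz
  have hsre : ∀ z ∈ ball (0 : ℂ) 1, 0 < (s z).re := by
    intro z hz
    have h1 : 0 < Complex.normSq (1 + z) := Complex.normSq_pos.2 (hden z hz)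
    have h2 : Complex.normSq z < 1 := by
      rw [Complex.normSq_eq_norm_sq]
      rw [mem_ball_zero_iff] at hz
      nlinarith [norm_nonneg z]
    rw [hs, Complex.div_re, ← add_div]
    refine div_pos ?_ h1
    rw [Complex.normSq_apply] at h2
    simp
    nlinarith
  set k : ℂ → ℂ := fun z => 1 - c + c * s z ^ 2 with hk
  have hslit : ∀ z ∈ ball (0 : ℂ) 1, k z ∈ Complex.slitPlane := by
    intro z hz
    have h1 := hsre z hz
    rw [Complex.mem_slitPlane_iff]
    have hre : (k z).re = 1 - c + c * ((s z).re ^ 2 - (s z).im ^ 2) := by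
      simp [hk, pow_two]
    have him : (k z).im = c * (2 * (s z).re * (s z).im) := by
      have : (s z ^ 2).im = 2 * (s z).re * (s z).im := by
        rw [pow_two, Complex.mul_im]
        ring
      simp only [hk, Complex.add_im, Complex.sub_im, Complex.one_im, Complex.ofReal_im,
        Complex.im_ofReal_mul, this]
      ring
    rcases eq_or_ne (s z).im 0 with h | h
    · left
      rw [hre, h]
      have : 0 < c * (s z).re ^ 2 := by positivity
      nlinarith
    · right
      rw [him]
      exact mul_ne_zero hc0.ne' (mul_ne_zero (by positivity) h)
  set S : ℂ → ℂ := fun z => Complex.exp (Complex.log (k z) / 2) with hS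
  have hSsq : ∀ z ∈ ball (0 : ℂ) 1, S z ^ 2 = k z := by
    intro z hz
    rw [hS, ← Complex.exp_nat_mul]
    simp only [Nat.cast_ofNat, mul_div_cancel₀ _ (two_ne_zero' ℂ)]
    rw [Complex.exp_log (Complex.slitPlane_ne_zero (hslit z hz))]
  have hSre : ∀ z ∈ ball (0 : ℂ) 1, 0 < (S z).re := by
    intro z hz
    rw [hS, Complex.exp_re]
    refine mul_pos (Real.exp_pos _) (Real.cos_pos_of_mem_Ioo ?_)
    have h1 := Complex.neg_pi_lt_log_im (k z)
    have h2 : (Complex.log (k z)).im < Real.pi := lt_of_le_of_ne (Complex.log_im_le_pi _)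
      (by rw [Complex.log_im]; exact (Complex.mem_slitPlane_iff_arg.1 (hslit z hz)).1)
    have h3 : (Complex.log (k z) / 2).im = (Complex.log (k z)).im / 2 := by simp
    rw [h3]
    constructor <;> linarith
  have hSden : ∀ z ∈ ball (0 : ℂ) 1, 1 + S z ≠ 0 := by
    intro z hz h
    have := congrArg Complex.re h
    simp at this
    linarith [hSre z hz]
  have hsd : ∀ z ∈ ball (0 : ℂ) 1, HasDerivAt s (-2 / (1 + z) ^ 2) z := by
    intro z hz
    refine (((hasDerivAt_id z).const_sub 1).fun_div ((hasDerivAt_id z).const_add 1)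
      (hden z hz)).congr_deriv ?_
    simp only [id]
    ring
  have hSd : ∀ z ∈ ball (0 : ℂ) 1, HasDerivAt S
      (S z * (c * (2 * s z * (-2 / (1 + z) ^ 2)) / k z / 2)) z := by
    intro z hz
    have h1 : HasDerivAt k (c * (2 * s z * (-2 / (1 + z) ^ 2))) z := by
      simpa [hk] using ((((hsd z hz).fun_pow 2).const_mul (c : ℂ)).const_add (1 - c : ℂ))
    exact ((h1.clog (hslit z hz)).div_const 2).cexp
  have hs0 : s 0 = 1 := by simp [hs]
  have hk0 : k 0 = 1 := by simp [hk, hs0]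
  have hS0 : S 0 = 1 := by simp [hS, hk0]
  have h0mem : (0 : ℂ) ∈ ball (0 : ℂ) 1 := by simp
  refine ⟨fun z => (1 - S z) / (1 + S z), ?_, ?_, ?_, ?_, ?_, ?_⟩
  · intro z hz
    have := (hSd z hz).differentiableAt
    exact ((this.const_sub 1).fun_div (this.const_add 1) (hSden z hz)).differentiableWithinAt
  · intro x hx y hy hxy
    simp only [div_eq_div_iff (hSden x hx) (hSden y hy)] at hxy
    have h1 : S x = S y := by linear_combination -hxy / 2
    have h2 : k x = k y := by rw [← hSsq x hx, ← hSsq y hy, h1]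
    have h3 : s x ^ 2 = s y ^ 2 := mul_left_cancel₀ hc0' (add_left_cancel h2)
    have h4 : s x = s y := by
      rcases sq_eq_sq_iff_eq_or_eq_neg.1 h3 with h | h
      · exact h
      · have := congrArg Complex.re h
        simp only [Complex.neg_re] at this
        linarith [hsre x hx, hsre y hy]
    simp only [hs, div_eq_div_iff (hden x hx) (hden y hy)] at h4
    linear_combination -h4 / 2
  · intro z hz
    rw [mem_ball_zero_iff, norm_div, div_lt_one (norm_pos_iff.2 (hSden z hz))]
    refine lt_of_pow_lt_pow_left₀ 2 (norm_nonneg _) ?_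
    rw [← Complex.normSq_eq_norm_sq, ← Complex.normSq_eq_norm_sq, Complex.normSq_apply,
      Complex.normSq_apply]
    simp
    nlinarith [hSre z hz]
  · simp [hS0]
  · have hd : HasDerivAt S (-2 * c) 0 := by
      refine (hSd 0 h0mem).congr_deriv ?_
      rw [hS0, hs0, hk0]
      ring
    have := (hd.const_sub 1).fun_div (hd.const_add 1) (hSden 0 h0mem)
    rw [this.deriv, hS0]
    ring
  · intro z hz h
    rw [div_eq_iff (hSden z hz)] at h
    have hr2 : (1 + r : ℂ) ≠ 0 := by exact_mod_cast (by positivity : (1 + r : ℝ) ≠ 0)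
    have h1 : S z = (1 - r) / (1 + r) := by
      rw [eq_div_iff hr2]
      linear_combination -h
    have h2 := hSsq z hz
    have h3 : (c : ℂ) * s z ^ 2 = 0 := by
      have : (c : ℂ) = 4 * r / (1 + r) ^ 2 := by simp [hc]
      simp only [hk, h1, this] at h2 ⊢
      have h4 : ((1 - r) / (1 + r) : ℂ) ^ 2 = 1 - 4 * r / (1 + r) ^ 2 := by
        field_simp
        ring
      rw [h4] at h2
      exact (add_eq_left.1 h2.symm)
    have h4 : s z = 0 := by simpa [hc0'] using h3
    have h5 := hsre z hz
    simp [h4] at h5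

open Set in
theorem norm_deriv_mul_div_le_norm {f : ℂ → ℂ} (hf : DifferentiableOn ℂ f (ball 0 1))
    (hinj : InjOn f (ball 0 1)) (h0 : f 0 = 0) {z : ℂ} (hz : z ∈ ball (0 : ℂ) 1) :
    ‖deriv f 0‖ * ‖z‖ / (1 + ‖z‖) ^ 2 ≤ ‖f z‖ := by
  rcases eq_or_ne z 0 with rfl | hz0
  · simp
  have hr0 : 0 < ‖z‖ := norm_pos_iff.2 hz0
  have hr1 : ‖z‖ < 1 := mem_ball_zero_iff.1 hz
  obtain ⟨φ, hφ, hφinj, hφmap, hφ0, hφd, hφr⟩ := exists_univalent_disc_to_slit_disc hr0 hr1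
  have hnz : (‖z‖ : ℂ) ≠ 0 := by exact_mod_cast hr0.ne'
  set u : ℂ := z / ‖z‖ with hu
  have hun : ‖u‖ = 1 := by simp [hu, hr0.ne']
  have hu0 : u ≠ 0 := norm_pos_iff.1 (by simp [hun])
  have hmaps : MapsTo (fun ζ => u * φ ζ) (ball 0 1) (ball 0 1) := fun ζ hζ => by
    simpa [hun] using hφmap hζ
  have h0mem : (0 : ℂ) ∈ ball (0 : ℂ) 1 := by simp
  have key := norm_deriv_le_four_mul_norm_of_ne (g := fun ζ => f (u * φ ζ)) (w := f z)
    (hf.comp (hφ.const_mul u) hmaps)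
    (fun x hx y hy hxy => hφinj hx hy (mul_left_cancel₀ hu0 (hinj (hmaps hx) (hmaps hy) hxy)))
    (by simp [hφ0, h0])
    (fun ζ hζ h => hφr ζ hζ (by
      have : u * φ ζ = z := hinj (hmaps hζ) hz h
      rw [hu, div_mul_eq_mul_div, div_eq_iff hnz] at this
      exact mul_left_cancel₀ hz0 this))
  have hd : HasDerivAt (fun ζ => f (u * φ ζ)) (deriv f 0 * (u * deriv φ 0)) 0 := by
    have h1 : HasDerivAt f (deriv f 0) (u * φ 0) := by
      rw [hφ0, mul_zero]
      exact (hf.differentiableAt (isOpen_ball.mem_nhds h0mem)).hasDerivAt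
    exact h1.comp 0 ((hφ.differentiableAt (isOpen_ball.mem_nhds h0mem)).hasDerivAt.const_mul u)
  rw [hd.deriv, hφd, norm_mul, norm_mul, hun, Complex.norm_real,
    Real.norm_of_nonneg (by positivity)] at key
  calc _ = ‖deriv f 0‖ * (1 * (4 * ‖z‖ / (1 + ‖z‖) ^ 2)) / 4 := by ring
    _ ≤ ‖f z‖ := by linarith

open Set ComplexConjugate in
theorem norm_deriv_mul_le_norm {f : ℂ → ℂ} (hf : DifferentiableOn ℂ f (ball 0 1))
    (hinj : InjOn f (ball 0 1)) (h0 : f 0 = 0) {z : ℂ} (hz : z ∈ ball (0 : ℂ) 1) :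
    ‖deriv f z‖ * (‖z‖ * (1 - ‖z‖) / (1 + ‖z‖)) ≤ ‖f z‖ := by
  have hr1 : ‖z‖ < 1 := mem_ball_zero_iff.1 hz
  have h0mem : (0 : ℂ) ∈ ball (0 : ℂ) 1 := by simp
  have hzz : z * conj z = (‖z‖ : ℂ) ^ 2 := Complex.mul_conj' z
  have hne : (1 - (‖z‖ : ℂ) ^ 2) ≠ 0 := by
    exact_mod_cast (by nlinarith [norm_nonneg z] : (1 - ‖z‖ ^ 2 : ℝ) ≠ 0)
  have hden : ∀ ζ ∈ ball (0 : ℂ) 1, 1 + conj z * ζ ≠ 0 := by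
    intro ζ hζ h
    have h1 : ‖conj z * ζ‖ = 1 := by
      rw [eq_neg_of_add_eq_zero_right h, norm_neg, norm_one]
    rw [norm_mul, RCLike.norm_conj] at h1
    rw [mem_ball_zero_iff] at hζ
    nlinarith [norm_nonneg z, norm_nonneg ζ]
  set T : ℂ → ℂ := fun ζ => (ζ + z) / (1 + conj z * ζ) with hT
  have hTd : ∀ ζ ∈ ball (0 : ℂ) 1,
      HasDerivAt T ((1 - (‖z‖ : ℂ) ^ 2) / (1 + conj z * ζ) ^ 2) ζ := by
    intro ζ hζ
    refine (((hasDerivAt_id ζ).add_const z).fun_div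
      (((hasDerivAt_id ζ).const_mul (conj z)).const_add 1) (hden ζ hζ)).congr_deriv ?_
    simp only [id, ← hzz]
    ring
  have hTmaps : MapsTo T (ball 0 1) (ball 0 1) := by
    intro ζ hζ
    rw [mem_ball_zero_iff, hT, norm_div, div_lt_one (norm_pos_iff.2 (hden ζ hζ))]
    refine lt_of_pow_lt_pow_left₀ 2 (norm_nonneg _) ?_
    have hz2 : Complex.normSq z < 1 := by
      rw [Complex.normSq_eq_norm_sq]
      nlinarith [norm_nonneg z]
    have hζ2 : Complex.normSq ζ < 1 := by
      rw [mem_ball_zero_iff] at hζ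
      rw [Complex.normSq_eq_norm_sq]
      nlinarith [norm_nonneg ζ]
    rw [← Complex.normSq_eq_norm_sq, ← Complex.normSq_eq_norm_sq]
    rw [Complex.normSq_apply] at hz2 hζ2 ⊢
    rw [Complex.normSq_apply]
    simp
    nlinarith [mul_pos (sub_pos.2 hz2) (sub_pos.2 hζ2)]
  have hTinj : InjOn T (ball 0 1) := by
    intro x hx y hy h
    simp only [hT, div_eq_div_iff (hden x hx) (hden y hy)] at h
    refine mul_left_cancel₀ hne ?_
    rw [← hzz]
    linear_combination h
  have hT0 : T 0 = z := by simp [hT]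
  have hTz : T (-z) = 0 := by simp [hT]
  have hnz : -z ∈ ball (0 : ℂ) 1 := by simpa using hr1
  have key := norm_deriv_mul_div_le_norm (f := fun ζ => f (T ζ) - f z) (z := -z)
    ((hf.comp (fun ζ hζ => (hTd ζ hζ).differentiableAt.differentiableWithinAt) hTmaps).sub_const _)
    (fun x hx y hy hxy => hTinj hx hy (hinj (hTmaps hx) (hTmaps hy) (sub_left_injective hxy)))
    (by simp [hT0]) hnz
  have hd : HasDerivAt (fun ζ => f (T ζ) - f z) (deriv f z * (1 - (‖z‖ : ℂ) ^ 2)) 0 := by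
    have h1 : HasDerivAt f (deriv f z) (T 0) := by
      rw [hT0]
      exact (hf.differentiableAt (isOpen_ball.mem_nhds hz)).hasDerivAt
    have h2 := (h1.comp 0 (hTd 0 h0mem)).sub_const (f z)
    simpa using h2
  have hnorm : ‖(1 - (‖z‖ : ℂ) ^ 2)‖ = 1 - ‖z‖ ^ 2 := by
    have : (1 - (‖z‖ : ℂ) ^ 2) = ((1 - ‖z‖ ^ 2 : ℝ) : ℂ) := by push_cast; rfl
    rw [this, Complex.norm_real, Real.norm_of_nonneg (by nlinarith [norm_nonneg z])]
  rw [hd.deriv, norm_mul, hnorm, hTz, h0, zero_sub, norm_neg, norm_neg] at key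
  refine le_of_eq_of_le ?_ key
  have : 1 + ‖z‖ ≠ 0 := by positivity
  field_simp
  ring

open Set in
theorem norm_le_norm_deriv_mul_div {f : ℂ → ℂ} (hf : DifferentiableOn ℂ f (ball 0 1))
    (hinj : InjOn f (ball 0 1)) (h0 : f 0 = 0) (hf' : deriv f 0 ≠ 0) {z : ℂ}
    (hz : z ∈ ball (0 : ℂ) 1) :
    ‖f z‖ ≤ ‖deriv f 0‖ * ‖z‖ / (1 - ‖z‖) ^ 2 := by
  rcases eq_or_ne z 0 with rfl | hz0
  · simp [h0]
  have hr0 : 0 < ‖z‖ := norm_pos_iff.2 hz0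
  have hr1 : ‖z‖ < 1 := mem_ball_zero_iff.1 hz
  have h0mem : (0 : ℂ) ∈ ball (0 : ℂ) 1 := by simp
  have hq : DifferentiableOn ℂ (dslope f 0) (ball 0 1) :=
    (Complex.differentiableOn_dslope (isOpen_ball.mem_nhds h0mem)).2 hf
  have hmul : ∀ z, f z = z * dslope f 0 z := fun z => by
    simpa [h0] using (sub_smul_dslope f 0 z).symm
  have hq0 : ∀ z ∈ ball (0 : ℂ) 1, dslope f 0 z ≠ 0 := by
    intro z hz h
    rcases eq_or_ne z 0 with rfl | hz0
    · exact hf' (by rwa [dslope_same] at h)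
    · exact hz0 (hinj hz h0mem (by rw [hmul z, h, mul_zero, h0]))
  obtain ⟨L, hL0, hL, hexp⟩ := hq.exists_eq_mul_exp_of_ne_zero one_pos hq0
  have hLre : ∀ ζ ∈ ball (0 : ℂ) 1, ζ ≠ 0 →
      (ζ * (deriv (dslope f 0) ζ / dslope f 0 ζ)).re ≤ 2 * ‖ζ‖ / (1 - ‖ζ‖) := by
    intro ζ hζ hζ0
    have hζn : 0 < ‖ζ‖ := norm_pos_iff.2 hζ0
    have hζ1 : 0 < 1 - ‖ζ‖ := sub_pos.2 (mem_ball_zero_iff.1 hζ)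
    have hqζ := hq0 ζ hζ
    have hd := (hq.differentiableAt (isOpen_ball.mem_nhds hζ)).hasDerivAt
    have hd' : HasDerivAt f (1 * dslope f 0 ζ + ζ * deriv (dslope f 0) ζ) ζ :=
      ((hasDerivAt_id ζ).mul hd).congr_of_eventuallyEq (Filter.Eventually.of_forall hmul)
    have h1 : deriv f ζ = dslope f 0 ζ * (1 + ζ * (deriv (dslope f 0) ζ / dslope f 0 ζ)) := by
      rw [hd'.deriv]
      field_simp
    have h2 := norm_deriv_mul_le_norm hf hinj h0 hζ
    rw [h1, hmul ζ, norm_mul, norm_mul] at h2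
    set P := ζ * (deriv (dslope f 0) ζ / dslope f 0 ζ)
    have hqn : 0 < ‖dslope f 0 ζ‖ := norm_pos_iff.2 hqζ
    have h3 : ‖1 + P‖ * ((1 - ‖ζ‖) / (1 + ‖ζ‖)) ≤ 1 := by
      refine le_of_mul_le_mul_left ?_ (mul_pos hζn hqn)
      refine le_trans (le_of_eq ?_) (h2.trans (mul_one _).ge)
      ring
    have h4 : (1 + P).re ≤ ‖1 + P‖ := Complex.re_le_norm _
    rw [mul_div_assoc', div_le_one (by positivity)] at h3
    rw [Complex.add_re, Complex.one_re] at h4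
    rw [le_div_iff₀ hζ1]
    nlinarith
  set u : ℂ := z / ‖z‖ with hu
  have hun : ‖u‖ = 1 := by simp [hu, hr0.ne']
  have hnorm : ∀ t : ℝ, 0 ≤ t → ‖(t : ℂ) * u‖ = t := fun t ht => by
    rw [norm_mul, hun, mul_one, Complex.norm_real, Real.norm_of_nonneg ht]
  have hder : ∀ t ∈ Icc 0 ‖z‖, HasDerivAt (fun t : ℝ => (L (t * u)).re + 2 * Real.log (1 - t))
      ((u * (deriv (dslope f 0) (t * u) / dslope f 0 (t * u))).re + 2 * (-1 / (1 - t))) t := by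
    intro t ht
    have hmem : (t : ℂ) * u ∈ ball (0 : ℂ) 1 := by
      rw [mem_ball_zero_iff, hnorm t ht.1]
      exact ht.2.trans_lt hr1
    have h1 : HasDerivAt (fun t : ℝ => (t : ℂ) * u) u t := by
      simpa using (Complex.ofRealCLM.hasDerivAt (x := t)).mul_const u
    have h2 := Complex.reCLM.hasFDerivAt.comp_hasDerivAt t ((hL _ hmem).scomp t h1)
    have h3 := (((hasDerivAt_id t).const_sub 1).log
      (by simp only [id]; linarith [ht.2] : 1 - id t ≠ 0)).const_mul 2
    exact h2.add h3
  have hanti : AntitoneOn (fun t : ℝ => (L (t * u)).re + 2 * Real.log (1 - t)) (Icc 0 ‖z‖) := by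
    refine antitoneOn_of_hasDerivWithinAt_nonpos (convex_Icc 0 ‖z‖)
      (fun t ht => (hder t ht).continuousAt.continuousWithinAt)
      (fun t ht => (hder t (interior_subset ht)).hasDerivWithinAt) ?_
    intro t ht
    rw [interior_Icc] at ht
    have hn := hnorm t ht.1.le
    have ht1 : 0 < 1 - t := by linarith [ht.2]
    have h1 := hLre (t * u) (by rw [mem_ball_zero_iff, hn]; linarith)
      (norm_pos_iff.1 (by rw [hn]; exact ht.1))
    rw [hn, mul_assoc, Complex.re_ofReal_mul] at h1
    have h2 : t * (u * (deriv (dslope f 0) (t * u) / dslope f 0 (t * u))).re ≤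
        t * (2 / (1 - t)) := h1.trans_eq (by ring)
    have h3 := le_of_mul_le_mul_left h2 ht.1
    have h4 : 2 * (-1 / (1 - t)) = -(2 / (1 - t)) := by ring
    rw [h4]
    linarith
  have hle := hanti (left_mem_Icc.2 hr0.le) (right_mem_Icc.2 hr0.le) hr0.le
  have hzu : (‖z‖ : ℂ) * u = z := by
    rw [hu, mul_div_cancel₀]
    exact_mod_cast hr0.ne'
  simp only [hzu, Complex.ofReal_zero, zero_mul, hL0, Complex.zero_re, sub_zero, Real.log_one,
    mul_zero, add_zero] at hle
  have h1r : 0 < 1 - ‖z‖ := sub_pos.2 hr1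
  have hexp_le : Real.exp (L z).re ≤ 1 / (1 - ‖z‖) ^ 2 := by
    rw [one_div, ← Real.exp_log (by positivity : (0 : ℝ) < ((1 - ‖z‖) ^ 2)⁻¹), Real.log_inv,
      Real.log_pow]
    refine Real.exp_le_exp.2 ?_
    push_cast
    linarith
  rw [hmul z, hexp z hz, dslope_same, norm_mul, norm_mul, Complex.norm_exp]
  calc ‖z‖ * (‖deriv f 0‖ * Real.exp (L z).re)
      ≤ ‖z‖ * (‖deriv f 0‖ * (1 / (1 - ‖z‖) ^ 2)) := by gcongr
    _ = _ := by ring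

theorem koebe_growth_theorem
    (f : ℂ → ℂ) (a : ℝ) (ha : 0 < a)
    (hdiff : DifferentiableOn ℂ f (Metric.ball 0 1))
    (hinj : Set.InjOn f (Metric.ball 0 1))
    (h0 : f 0 = 0) (hderiv : ‖deriv f 0‖ = a) :
    ∀ z ∈ Metric.ball (0:ℂ) 1,
      a * ‖z‖ / (1 + ‖z‖) ^ 2 ≤ ‖f z‖ ∧ ‖f z‖ ≤ a * ‖z‖ / (1 - ‖z‖) ^ 2 := by
  intro z hz
  subst hderiv
  exact ⟨norm_deriv_mul_div_le_norm hdiff hinj h0 hz,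
    norm_le_norm_deriv_mul_div hdiff hinj h0 (norm_pos_iff.1 ha) hz⟩
end
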